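/- arXiv:2303.08165 — 2 statements merged into one kernel-verified Lean document; each statement's English description precedes it below -/
import Mathlib

section
/- Let k be a division ring, let H be a locally indicable group, let φ : kH → D be a Hughes-free embedding into a division ring D, and let α : H → H be a group automorphism; let kα : kH → kH denote the ring automorphism of the group algebra obtained by extending α (fixing k and sending each basis element h to α(h)). Then there exists a ring automorphism α' : D → D such that α' ∘ φ = φ ∘ kα. -/
/-- A subring `S` of a ring `R` is a *division subring* if every nonzero element of `S`
has a two-sided inverse lying in `S`. -/
def IsDivisionSubring {R : Type*} [Ring R] (S : Subring R) : Prop :=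
  ∀ x ∈ S, x ≠ 0 → ∃ y ∈ S, x * y = 1 ∧ y * x = 1

/-- The *division closure* of a subset `s` of a ring `R`: the smallest division subring
of `R` containing `s` (realized as the infimum of all division subrings containing `s`). -/
def divisionClosure {R : Type*} [Ring R] (s : Set R) : Subring R :=
  sInf {S : Subring R | IsDivisionSubring S ∧ s ⊆ S}

lemma subset_divisionClosure {R : Type*} [Ring R] (s : Set R) :
    s ⊆ (divisionClosure s : Set R) := fun _x hx =>
  Subring.mem_sInf.2 fun _S hS => hS.2 hx

/-- Integer powers of an element of a ring, using `Ring.inverse` for negative exponents.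
When the ambient ring is a division ring this agrees with the usual `zpow`. -/
noncomputable def ringZPow {R : Type*} [Ring R] (x : R) (i : ℤ) : R :=
  if 0 ≤ i then x ^ i.toNat else (Ring.inverse x) ^ (-i).toNat

/-- A group is *locally indicable* if every nontrivial finitely generated subgroup
admits a surjective homomorphism onto `ℤ`. -/
def LocallyIndicable (G : Type*) [Group G] : Prop :=
  ∀ H : Subgroup G, H ≠ ⊥ → H.FG →
    ∃ f : H →* Multiplicative ℤ, Function.Surjective f

/-- `φ : kG →+* D` is a *Hughes-free embedding* if it is injective, the division closure
of its image is all of `D`, and whenever `H ≤ G` is finitely generated, `K ⊴ H` and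
`t ∈ H` are such that `H/K` is infinite cyclic generated by `tK`, the integer powers of
`φ t` are left linearly independent over the division closure of `φ (kK)` in `D`. -/
def IsHughesFreeEmbedding {k : Type*} [DivisionRing k] {G : Type*} [Group G]
    {D : Type*} [Ring D] (φ : MonoidAlgebra k G →+* D) : Prop :=
  Function.Injective φ ∧
  divisionClosure (Set.range φ) = ⊤ ∧
  ∀ (H : Subgroup G), H.FG → ∀ (K : Subgroup H) (t : H),
    (∃ f : H →* Multiplicative ℤ,
        Function.Surjective f ∧ f.ker = K ∧ f t = Multiplicative.ofAdd 1) →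
    ∀ c : ℤ →₀ D,
      (∀ i : ℤ, c i ∈ divisionClosure
          (Set.range (φ.comp (MonoidAlgebra.mapDomainRingHom k (H.subtype.comp K.subtype))))) →
      (c.sum fun i a => a * ringZPow (φ (MonoidAlgebra.of k G (H.subtype t))) i) = 0 →
      c = 0

/-- A topological space is a *3-manifold* if it is nonempty, connected, Hausdorff,
second countable, and every point has an open neighbourhood homeomorphic to `ℝ³`. -/
def Is3Manifold (M : Type*) [TopologicalSpace M] : Prop :=
  Nonempty M ∧ ConnectedSpace M ∧ T2Space M ∧ SecondCountableTopology M ∧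
    ∀ x : M, ∃ U : Set M, IsOpen U ∧ x ∈ U ∧ Nonempty (U ≃ₜ (Fin 3 → ℝ))

/-- Ordinals, to be equipped with the natural (Hessenberg) addition. -/
def Weight : Type 1 := Ordinal.{0}

namespace Weight

noncomputable instance : LinearOrder Weight := inferInstanceAs (LinearOrder Ordinal.{0})
instance : WellFoundedLT Weight := inferInstanceAs (WellFoundedLT Ordinal.{0})
noncomputable instance : Zero Weight := inferInstanceAs (Zero Ordinal.{0})

/-- The natural sum of two ordinals. -/
noncomputable def nadd (a b : Ordinal.{0}) : Ordinal.{0} :=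
  max (⨆ x : Set.Iio a, Order.succ (nadd x.1 b)) (⨆ x : Set.Iio b, Order.succ (nadd a x.1))
termination_by (a, b)
decreasing_by
  · exact Prod.Lex.left _ _ x.2
  · exact Prod.Lex.right _ x.2

lemma lt_nadd_iff {a b c : Ordinal.{0}} :
    a < nadd b c ↔ (∃ b' < b, a ≤ nadd b' c) ∨ ∃ c' < c, a ≤ nadd b c' := by
  rw [nadd, lt_max_iff, Ordinal.lt_iSup_iff, Ordinal.lt_iSup_iff]
  simp only [Order.lt_succ_iff, Subtype.exists, Set.mem_Iio, exists_prop]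

lemma nadd_lt_left {b c : Ordinal.{0}} (h : b < c) (a : Ordinal.{0}) : nadd a b < nadd a c :=
  lt_nadd_iff.2 (Or.inr ⟨b, h, le_rfl⟩)

lemma nadd_lt_right {b c : Ordinal.{0}} (h : b < c) (a : Ordinal.{0}) : nadd b a < nadd c a :=
  lt_nadd_iff.2 (Or.inl ⟨b, h, le_rfl⟩)

lemma nadd_le_right {b c : Ordinal.{0}} (h : b ≤ c) (a : Ordinal.{0}) : nadd b a ≤ nadd c a :=
  h.eq_or_lt.elim (fun h => h ▸ le_rfl) fun h => (nadd_lt_right h a).le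

lemma nadd_comm (a b : Ordinal.{0}) : nadd a b = nadd b a := by
  refine eq_of_forall_lt_iff fun c => ?_
  rw [lt_nadd_iff, lt_nadd_iff, or_comm]
  refine or_congr (exists_congr fun b' => and_congr_right fun hb => ?_)
    (exists_congr fun a' => and_congr_right fun ha => ?_)
  · rw [nadd_comm a b']
  · rw [nadd_comm a' b]
termination_by (a, b)

lemma nadd_zero (a : Ordinal.{0}) : nadd a 0 = a := by
  refine eq_of_forall_lt_iff fun c => ?_
  rw [lt_nadd_iff]
  constructor
  · rintro (⟨a', ha, h⟩ | ⟨c', h, -⟩)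
    · rw [nadd_zero a'] at h
      exact h.trans_lt ha
    · exact absurd h not_lt_zero
  · intro h
    exact Or.inl ⟨c, h, (nadd_zero c).ge⟩
termination_by a

lemma nadd_assoc_le (a b c : Ordinal.{0}) : nadd (nadd a b) c ≤ nadd a (nadd b c) := by
  refine le_of_forall_lt fun d hd => ?_
  rcases lt_nadd_iff.1 hd with ⟨e, he, hde⟩ | ⟨c', hc, hdc⟩
  · rcases lt_nadd_iff.1 he with ⟨a', ha, hea⟩ | ⟨b', hb, heb⟩
    · exact ((hde.trans (nadd_le_right hea c)).trans (nadd_assoc_le a' b c)).trans_lt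
        (nadd_lt_right ha _)
    · exact ((hde.trans (nadd_le_right heb c)).trans (nadd_assoc_le a b' c)).trans_lt
        (nadd_lt_left (nadd_lt_right hb _) _)
  · exact (hdc.trans (nadd_assoc_le a b c')).trans_lt (nadd_lt_left (nadd_lt_left hc _) _)
termination_by (a, b, c)

lemma nadd_assoc (a b c : Ordinal.{0}) : nadd (nadd a b) c = nadd a (nadd b c) := by
  refine (nadd_assoc_le a b c).antisymm ?_
  have h := nadd_assoc_le c b a
  rwa [nadd_comm c b, nadd_comm (nadd b c) a, nadd_comm b a, nadd_comm c] at h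

noncomputable instance : Add Weight := ⟨nadd⟩

noncomputable instance : AddCommMonoid Weight where
  add_assoc := nadd_assoc
  zero_add a := (nadd_comm 0 a).trans (nadd_zero a)
  add_zero := nadd_zero
  add_comm := nadd_comm
  nsmul := nsmulRec

instance : IsOrderedCancelAddMonoid Weight where
  add_le_add_left _ _ h c := nadd_le_right h c
  le_of_add_le_add_left a b c h := by
    by_contra! hlt
    exact absurd h (not_le.2 (nadd_lt_left hlt a))

noncomputable instance : One Weight := inferInstanceAs (One Ordinal.{0})

protected lemma zero_le (a : Weight) : 0 ≤ a := bot_le (α := Ordinal.{0})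

lemma one_pos : (0 : Weight) < 1 := zero_lt_one (α := Ordinal.{0})

lemma one_le_iff {a : Weight} : 1 ≤ a ↔ 0 < a := Order.one_le_iff_pos (α := Ordinal.{0})

/-- A strictly monotone, superadditive product of ordinals. -/
noncomputable def nmul (a b : Ordinal.{0}) : Ordinal.{0} :=
  open Classical in
  if a = 0 ∨ b = 0 then 0 else
    max
      (⨆ p : Set.Iio a × Set.Iio a,
        max (Order.succ (nmul p.1.1 b))
          (if nadd p.1.1 p.2.1 ≤ a then nadd (nmul p.1.1 b) (nmul p.2.1 b) else 0))
      (⨆ p : Set.Iio b × Set.Iio b,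
        max (Order.succ (nmul a p.1.1))
          (if nadd p.1.1 p.2.1 ≤ b then nadd (nmul a p.1.1) (nmul a p.2.1) else 0))
termination_by (a, b)
decreasing_by
  · exact Prod.Lex.left _ _ p.1.2
  · exact Prod.Lex.left _ _ p.2.2
  · exact Prod.Lex.right _ p.1.2
  · exact Prod.Lex.right _ p.2.2

lemma ordinal_pos_of_gt {a b : Ordinal.{0}} (h : a < b) : 0 < b := bot_le.trans_lt h

lemma zero_nmul (b : Ordinal.{0}) : nmul 0 b = 0 := by
  rw [nmul, if_pos (Or.inl rfl)]

lemma nmul_zero (a : Ordinal.{0}) : nmul a 0 = 0 := by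
  rw [nmul, if_pos (Or.inr rfl)]

lemma nmul_lt_right {a a' b : Ordinal.{0}} (h : a' < a) (hb : b ≠ 0) : nmul a' b < nmul a b := by
  rw [nmul.eq_def a b, if_neg (not_or.2 ⟨(ordinal_pos_of_gt h).ne', hb⟩)]
  refine lt_max_of_lt_left (Ordinal.lt_iSup_iff.2 ⟨(⟨a', h⟩, ⟨a', h⟩), lt_max_of_lt_left ?_⟩)
  exact Order.lt_succ _

lemma nmul_lt_left {a b b' : Ordinal.{0}} (h : b' < b) (ha : a ≠ 0) : nmul a b' < nmul a b := by
  rw [nmul.eq_def a b, if_neg (not_or.2 ⟨ha, (ordinal_pos_of_gt h).ne'⟩)]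
  refine lt_max_of_lt_right (Ordinal.lt_iSup_iff.2 ⟨(⟨b', h⟩, ⟨b', h⟩), lt_max_of_lt_left ?_⟩)
  exact Order.lt_succ _

lemma nadd_nmul_le {a a' c b : Ordinal.{0}} (h : a < c) (h' : a' < c) (hc : nadd a a' ≤ c)
    (hb : b ≠ 0) : nadd (nmul a b) (nmul a' b) ≤ nmul c b := by
  rw [nmul.eq_def c b, if_neg (not_or.2 ⟨(ordinal_pos_of_gt h).ne', hb⟩)]
  refine le_max_of_le_left (le_trans ?_ (Ordinal.le_iSup _ (⟨a, h⟩, ⟨a', h'⟩)))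
  refine le_max_of_le_right ?_
  rw [if_pos hc]

lemma nmul_nadd_le {a b b' c : Ordinal.{0}} (h : b < c) (h' : b' < c) (hc : nadd b b' ≤ c)
    (ha : a ≠ 0) : nadd (nmul a b) (nmul a b') ≤ nmul a c := by
  rw [nmul.eq_def a c, if_neg (not_or.2 ⟨ha, (ordinal_pos_of_gt h).ne'⟩)]
  refine le_max_of_le_right (le_trans ?_ (Ordinal.le_iSup _ (⟨b, h⟩, ⟨b', h'⟩)))
  refine le_max_of_le_right ?_
  rw [if_pos hc]

/-- A strictly monotone, superadditive product of weights. -/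
noncomputable def mul (a b : Weight) : Weight := nmul a b

@[simp] lemma zero_mul (b : Weight) : mul 0 b = 0 := zero_nmul b

@[simp] lemma mul_zero (a : Weight) : mul a 0 = 0 := nmul_zero a

lemma mul_lt_right {a a' b : Weight} (h : a' < a) (hb : 0 < b) : mul a' b < mul a b :=
  nmul_lt_right h hb.ne'

lemma mul_lt_left {a b b' : Weight} (h : b' < b) (ha : 0 < a) : mul a b' < mul a b :=
  nmul_lt_left h ha.ne'

lemma add_mul_le (a a' b : Weight) : mul a b + mul a' b ≤ mul (a + a') b := by
  rcases (Weight.zero_le a).eq_or_lt with rfl | ha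
  · simp
  rcases (Weight.zero_le a').eq_or_lt with rfl | ha'
  · simp
  rcases (Weight.zero_le b).eq_or_lt with rfl | hb
  · simp
  have h : a < a + a' := lt_add_of_pos_right a ha'
  have h' : a' < a + a' := lt_add_of_pos_left a' ha
  exact nadd_nmul_le h h' le_rfl hb.ne'

lemma mul_add_le (a b b' : Weight) : mul a b + mul a b' ≤ mul a (b + b') := by
  rcases (Weight.zero_le a).eq_or_lt with rfl | ha
  · simp
  rcases (Weight.zero_le b).eq_or_lt with rfl | hb
  · simp
  rcases (Weight.zero_le b').eq_or_lt with rfl | hb'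
  · simp
  have h : b < b + b' := lt_add_of_pos_right b hb'
  have h' : b' < b + b' := lt_add_of_pos_left b' hb
  exact nmul_nadd_le h h' le_rfl ha.ne'

lemma mul_le_mul {a a' b b' : Weight} (ha : a ≤ a') (hb : b ≤ b') : mul a b ≤ mul a' b' := by
  rcases (Weight.zero_le a).eq_or_lt with rfl | ha0
  · simpa using Weight.zero_le _
  rcases (Weight.zero_le b).eq_or_lt with rfl | hb0
  · simpa using Weight.zero_le _
  refine le_trans (b := mul a' b) ?_ ?_
  · exact ha.eq_or_lt.elim (fun h => h ▸ le_rfl) fun h => (mul_lt_right h hb0).le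
  · exact hb.eq_or_lt.elim (fun h => h ▸ le_rfl) fun h => (mul_lt_left h (ha0.trans_le ha)).le

lemma le_mul_right {a b : Weight} (hb : 0 < b) : a ≤ mul a b := by
  have h : StrictMono fun x : Weight => mul x b := fun _ _ h => mul_lt_right h hb
  exact h.le_apply

lemma le_mul_left {a b : Weight} (ha : 0 < a) : b ≤ mul a b := by
  have h : StrictMono fun x : Weight => mul a x := fun _ _ h => mul_lt_left h ha
  exact h.le_apply

lemma mul_pos {a b : Weight} (ha : 0 < a) (hb : 0 < b) : 0 < mul a b :=
  ha.trans_le (le_mul_right hb)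

lemma sum_mul_le {ι : Type*} (s : Finset ι) (f : ι → Weight) (b : Weight) :
    ∑ i ∈ s, mul (f i) b ≤ mul (∑ i ∈ s, f i) b := by
  classical
  induction s using Finset.induction_on with
  | empty => simp
  | insert i s hi ih =>
    rw [Finset.sum_insert hi, Finset.sum_insert hi]
    exact (add_le_add_right ih _).trans (add_mul_le _ _ _)

lemma mul_sum_le {ι : Type*} (s : Finset ι) (f : ι → Weight) (a : Weight) :
    ∑ i ∈ s, mul a (f i) ≤ mul a (∑ i ∈ s, f i) := by
  classical
  induction s using Finset.induction_on with
  | empty => simp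
  | insert i s hi ih =>
    rw [Finset.sum_insert hi, Finset.sum_insert hi]
    exact (add_le_add_right ih _).trans (mul_add_le _ _ _)

lemma sum_sum_mul_le {ι κ : Type*} (s : Finset ι) (t : Finset κ) (f : ι → Weight)
    (g : κ → Weight) :
    ∑ p ∈ s ×ˢ t, mul (f p.1) (g p.2) ≤ mul (∑ i ∈ s, f i) (∑ j ∈ t, g j) := by
  rw [Finset.sum_product]
  exact (Finset.sum_le_sum fun i _ => mul_sum_le t g (f i)).trans (sum_mul_le _ _ _)

/-- An auxiliary operation whose principal ordinals are closed under both operations on weights. -/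
noncomputable def bound (a b : Ordinal.{0}) : Ordinal.{0} :=
  Order.succ (max (nadd a b) (nmul a b))

/-- The enumeration of the weights closed under addition and multiplication of weights. -/
noncomputable def exp (a : Weight) : Weight :=
  Ordinal.enumOrd {o | Ordinal.IsPrincipal bound o} a

lemma exp_lt_exp {a b : Weight} (h : a < b) : exp a < exp b :=
  Ordinal.enumOrd_strictMono (Ordinal.not_bddAbove_setOfPred_isPrincipal _) h

lemma exp_le_exp {a b : Weight} (h : a ≤ b) : exp a ≤ exp b :=
  h.eq_or_lt.elim (fun h => h ▸ le_rfl) fun h => (exp_lt_exp h).le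

lemma le_exp (a : Weight) : a ≤ exp a :=
  Ordinal.le_enumOrd_self (Ordinal.not_bddAbove_setOfPred_isPrincipal _)

lemma isPrincipal_exp (a : Weight) : Ordinal.IsPrincipal bound (exp a) :=
  Ordinal.enumOrd_mem (Ordinal.not_bddAbove_setOfPred_isPrincipal bound) a

lemma add_lt_exp {a b c : Weight} (ha : a < exp c) (hb : b < exp c) : a + b < exp c :=
  lt_of_le_of_lt (le_trans (le_max_left _ _) (Order.le_succ (α := Ordinal.{0}) _))
    (isPrincipal_exp c ha hb)

lemma mul_lt_exp {a b c : Weight} (ha : a < exp c) (hb : b < exp c) : mul a b < exp c :=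
  lt_of_le_of_lt (le_trans (le_max_right _ _) (Order.le_succ (α := Ordinal.{0}) _))
    (isPrincipal_exp c ha hb)

lemma one_lt_exp {c : Weight} (hc : 0 < c) : 1 < exp c := by
  have h0 : 0 < exp c := hc.trans_le (le_exp c)
  refine lt_of_le_of_lt ?_ (isPrincipal_exp c h0 h0)
  exact one_le_iff.2 (Order.bot_lt_succ (α := Ordinal.{0}) _)

lemma sum_lt_exp {ι : Type*} {c : Weight} (hc : 0 < c) (s : Finset ι) (f : ι → Weight)
    (hf : ∀ i ∈ s, f i < exp c) : ∑ i ∈ s, f i < exp c := by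
  classical
  induction s using Finset.induction_on with
  | empty => simpa using one_pos.trans (one_lt_exp hc)
  | insert i s hi ih =>
    rw [Finset.sum_insert hi]
    exact add_lt_exp (hf i (Finset.mem_insert_self i s))
      (ih fun j hj => hf j (Finset.mem_insert_of_mem hj))

end Weight

open scoped LaurentPolynomial

section TwistedLaurent

/-- A division subring `K` together with a nonzero element `τ` normalizing it, whose integer powers
are left linearly independent over `K`. -/
structure TwistedLaurentData (D : Type*) [DivisionRing D] where
  /-- the coefficient division ring -/
  K : Subfield D
  /-- the twisting element -/
  τ : D
  τ_ne_zero : τ ≠ 0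
  conj_mem : ∀ (n : ℤ), ∀ d ∈ K, τ ^ n * d * τ ^ (-n) ∈ K
  indep : ∀ c : ℤ →₀ D, (∀ i, c i ∈ K) → (c.sum fun i a => a * τ ^ i) = 0 → c = 0

/-- The augmentation of the Laurent polynomial ring with central variable. -/
noncomputable def laurentAug (D : Type*) [DivisionRing D] : D[T;T⁻¹] →+* D :=
  AddMonoidAlgebra.liftNCRingHom (RingHom.id D) 1 fun _ _ => Commute.one_right _

/-- The inclusion of Laurent polynomials into Laurent series. -/
noncomputable def laurentToSeries (D : Type*) [DivisionRing D] : D[T;T⁻¹] →+* HahnSeries ℤ D :=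
  AddMonoidAlgebra.liftNCRingHom HahnSeries.C
    { toFun := fun n => HahnSeries.single n.toAdd 1
      map_one' := rfl
      map_mul' := fun a b => by simp }
    fun a n => by
      change HahnSeries.single 0 a * HahnSeries.single n.toAdd 1 =
        HahnSeries.single n.toAdd 1 * HahnSeries.single 0 a
      simp

lemma laurentAug_single {D : Type*} [DivisionRing D] (n : ℤ) (a : D) :
    laurentAug D (AddMonoidAlgebra.single n a) = a := by
  change AddMonoidAlgebra.liftNC _ _ _ = _
  rw [AddMonoidAlgebra.liftNC_single]
  exact mul_one a

lemma laurentAug_eq_sum {D : Type*} [DivisionRing D] (p : D[T;T⁻¹]) :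
    laurentAug D p = p.coeff.sum fun _ a => a := by
  induction p using AddMonoidAlgebra.induction_linear with
  | zero => simp
  | add f g hf hg =>
    rw [map_add, hf, hg, AddMonoidAlgebra.coeff_add, Finsupp.sum_add_index'] <;> simp
  | single n a =>
    rw [laurentAug_single, AddMonoidAlgebra.coeff_single, Finsupp.sum_single_index rfl]

lemma laurentToSeries_single {D : Type*} [DivisionRing D] (n : ℤ) (a : D) :
    laurentToSeries D (AddMonoidAlgebra.single n a) = HahnSeries.single n a := by
  change AddMonoidAlgebra.liftNC _ _ _ = _
  rw [AddMonoidAlgebra.liftNC_single]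
  change HahnSeries.single 0 a * HahnSeries.single n 1 = HahnSeries.single n a
  simp

lemma coeff_laurentToSeries {D : Type*} [DivisionRing D] (p : D[T;T⁻¹]) (n : ℤ) :
    (laurentToSeries D p).coeff n = p.coeff n := by
  induction p using AddMonoidAlgebra.induction_linear with
  | zero => simp
  | add f g hf hg => simp [hf, hg]
  | single m a =>
    rw [laurentToSeries_single, HahnSeries.coeff_single, AddMonoidAlgebra.coeff_single,
      Finsupp.single_apply]
    simp [eq_comm]

lemma laurentToSeries_injective (D : Type*) [DivisionRing D] :
    Function.Injective (laurentToSeries D) := fun p q h => by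
  ext n
  rw [← coeff_laurentToSeries, h, coeff_laurentToSeries]

namespace TwistedLaurentData

variable {D : Type*} [DivisionRing D] (L : TwistedLaurentData D)

/-- The elements of `K * τ ^ n`. -/
def Homogeneous (n : ℤ) (x : D) : Prop := x * L.τ ^ (-n) ∈ L.K

variable {L}

lemma homogeneous_iff {n : ℤ} {x : D} :
    L.Homogeneous n x ↔ ∃ d ∈ L.K, x = d * L.τ ^ n := by
  constructor
  · intro h
    refine ⟨_, h, ?_⟩
    rw [mul_assoc, ← zpow_add₀ L.τ_ne_zero]
    simp
  · rintro ⟨d, hd, rfl⟩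
    rw [Homogeneous, mul_assoc, ← zpow_add₀ L.τ_ne_zero]
    simpa

lemma Homogeneous.zero (n : ℤ) : L.Homogeneous n 0 := by
  simp [Homogeneous, L.K.zero_mem]

lemma Homogeneous.add {n : ℤ} {x y : D} (hx : L.Homogeneous n x) (hy : L.Homogeneous n y) :
    L.Homogeneous n (x + y) := by
  rw [Homogeneous, add_mul]
  exact L.K.add_mem hx hy

lemma Homogeneous.neg {n : ℤ} {x : D} (hx : L.Homogeneous n x) : L.Homogeneous n (-x) := by
  rw [Homogeneous, neg_mul]
  exact L.K.neg_mem hx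

lemma Homogeneous.sum {ι : Type*} {n : ℤ} {s : Finset ι} {f : ι → D}
    (h : ∀ i ∈ s, L.Homogeneous n (f i)) : L.Homogeneous n (∑ i ∈ s, f i) := by
  rw [Homogeneous, Finset.sum_mul]
  exact sum_mem h

lemma Homogeneous.mul {m n : ℤ} {x y : D} (hx : L.Homogeneous m x) (hy : L.Homogeneous n y) :
    L.Homogeneous (m + n) (x * y) := by
  obtain ⟨d, hd, rfl⟩ := homogeneous_iff.1 hx
  obtain ⟨e, he, rfl⟩ := homogeneous_iff.1 hy
  refine homogeneous_iff.2 ⟨d * (L.τ ^ m * e * L.τ ^ (-m)), L.K.mul_mem hd (L.conj_mem m e he), ?_⟩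
  rw [zpow_add₀ L.τ_ne_zero]
  simp only [mul_assoc]
  rw [← mul_assoc (L.τ ^ (-m)), ← zpow_add₀ L.τ_ne_zero]
  simp

lemma Homogeneous.inv {n : ℤ} {x : D} (hx : L.Homogeneous n x) : L.Homogeneous (-n) x⁻¹ := by
  obtain ⟨d, hd, rfl⟩ := homogeneous_iff.1 hx
  refine homogeneous_iff.2 ⟨L.τ ^ (-n) * d⁻¹ * L.τ ^ (- -n), L.conj_mem _ _ (L.K.inv_mem hd), ?_⟩
  rw [mul_assoc, ← zpow_add₀ L.τ_ne_zero]
  simp [mul_inv_rev]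

variable (L)

/-- The twisted Laurent polynomial ring, realized inside Laurent polynomials with central
variable. -/
def poly : Subring D[T;T⁻¹] where
  carrier := {p | ∀ n, L.Homogeneous n (p.coeff n)}
  zero_mem' n := by simpa using Homogeneous.zero n
  one_mem' n := by
    rw [AddMonoidAlgebra.one_def, AddMonoidAlgebra.coeff_single, Finsupp.single_apply]
    split_ifs with h
    · subst h
      simp [Homogeneous, L.K.one_mem]
    · exact Homogeneous.zero n
  add_mem' hp hq n := by
    rw [AddMonoidAlgebra.coeff_add]
    exact (hp n).add (hq n)
  neg_mem' hp n := by
    rw [AddMonoidAlgebra.coeff_neg]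
    exact (hp n).neg
  mul_mem' {p q} hp hq n := by
    rw [← coeff_laurentToSeries, map_mul, HahnSeries.coeff_mul]
    refine Homogeneous.sum fun ij hij => ?_
    rw [coeff_laurentToSeries, coeff_laurentToSeries, ← (Finset.mem_antidiagonal.1 hij).2.2]
    exact (hp _).mul (hq _)

variable {L}

lemma single_mem_poly {n : ℤ} {x : D} (hx : L.Homogeneous n x) :
    AddMonoidAlgebra.single n x ∈ L.poly := fun m => by
  rw [AddMonoidAlgebra.coeff_single, Finsupp.single_apply]
  split_ifs with h
  · exact h ▸ hx
  · exact Homogeneous.zero m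

lemma eq_zero_of_laurentAug_eq_zero {p : D[T;T⁻¹]} (hp : p ∈ L.poly) (h : laurentAug D p = 0) :
    p = 0 := by
  classical
  let c : ℤ →₀ D := Finsupp.onFinset p.coeff.support (fun n => p.coeff n * L.τ ^ (-n))
    (fun n hn => Finsupp.mem_support_iff.2 fun h0 => hn (by simp [h0]))
  have hc : c = 0 := by
    refine L.indep c (fun i => hp i) ?_
    rw [laurentAug_eq_sum] at h
    rw [Finsupp.onFinset_sum _ (by simp), ← h]
    refine Finset.sum_congr rfl fun i _ => ?_
    rw [mul_assoc, ← zpow_add₀ L.τ_ne_zero]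
    simp
  ext n
  have hn : c n = 0 := by rw [hc]; rfl
  simpa [c, L.τ_ne_zero, zpow_ne_zero] using hn

instance : NoZeroDivisors D[T;T⁻¹] where
  eq_zero_or_eq_zero_of_mul_eq_zero {p q} h := by
    have h' := congrArg (laurentToSeries D) h
    rw [map_mul, map_zero, mul_eq_zero] at h'
    exact h'.imp (fun h => laurentToSeries_injective D (by rw [h, map_zero]))
      (fun h => laurentToSeries_injective D (by rw [h, map_zero]))

lemma coeff_single_mul (m : ℤ) (c : D) (p : D[T;T⁻¹]) (n : ℤ) :
    (AddMonoidAlgebra.single m c * p).coeff n = c * p.coeff (n - m) := by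
  rw [← coeff_laurentToSeries, ← coeff_laurentToSeries, map_mul, laurentToSeries_single]
  have := HahnSeries.coeff_single_mul_add (r := c) (x := laurentToSeries D p) (a := n - m) (b := m)
  rwa [sub_add_cancel] at this

/-- Division with remainder in the twisted Laurent polynomial ring. -/
lemma exists_sub_mul_support {p : D[T;T⁻¹]} (hp : p ∈ L.poly) {a : ℤ} {d : ℕ}
    (ha : p.coeff (a + d) ≠ 0) (hs : ∀ n, p.coeff n ≠ 0 → a ≤ n ∧ n ≤ a + d) (m : ℕ) (b : ℤ) :
    ∀ q ∈ L.poly, (∀ n, q.coeff n ≠ 0 → b ≤ n ∧ n < b + m) →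
      ∃ s ∈ L.poly, ∃ b' : ℤ, ∀ n, (q - s * p).coeff n ≠ 0 → b' ≤ n ∧ n < b' + d := by
  induction m with
  | zero =>
    intro q _ hqs
    refine ⟨0, L.poly.zero_mem, b, fun n hn => ?_⟩
    have := hqs n (by simpa using hn)
    omega
  | succ m ih =>
    intro q hq hqs
    by_cases hmd : m < d
    · refine ⟨0, L.poly.zero_mem, b, fun n hn => ?_⟩
      have := hqs n (by simpa using hn)
      omega
    set c : D := q.coeff (b + m) * (p.coeff (a + d))⁻¹ with hc
    set s₀ : D[T;T⁻¹] := AddMonoidAlgebra.single (b + m - (a + d)) c with hs₀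
    have hs₀m : s₀ ∈ L.poly := single_mem_poly ((hq _).mul (hp _).inv)
    obtain ⟨s, hsm, b', hb'⟩ := ih (q - s₀ * p) (L.poly.sub_mem hq (L.poly.mul_mem hs₀m hp))
      (fun n hn => by
        rw [AddMonoidAlgebra.coeff_sub, Finsupp.sub_apply, hs₀, coeff_single_mul] at hn
        have h1 : n ≠ b + m := by
          rintro rfl
          apply hn
          rw [show b + m - (b + m - (a + d)) = a + (d : ℤ) by ring, hc, mul_assoc,
            inv_mul_cancel₀ ha, mul_one, sub_self]
        by_cases hqn : q.coeff n = 0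
        · have := hs (n - (b + m - (a + d))) fun h => hn (by rw [hqn, h]; simp)
          omega
        · have := hqs n hqn
          omega)
    refine ⟨s + s₀, L.poly.add_mem hsm hs₀m, b', fun n hn => hb' n ?_⟩
    rwa [add_mul, add_comm, ← sub_sub] at hn

lemma exists_support_bounds (p : D[T;T⁻¹]) :
    ∃ (b : ℤ) (m : ℕ), ∀ n, p.coeff n ≠ 0 → b ≤ n ∧ n < b + m := by
  rcases p.coeff.support.eq_empty_or_nonempty with h | h
  · refine ⟨0, 0, fun n hn => ?_⟩
    rw [← Finsupp.mem_support_iff, h] at hn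
    simp at hn
  · refine ⟨p.coeff.support.min' h, (p.coeff.support.max' h - p.coeff.support.min' h + 1).toNat,
      fun n hn => ?_⟩
    have h1 := Finset.min'_le _ n (Finsupp.mem_support_iff.2 hn)
    have h2 := Finset.le_max' _ n (Finsupp.mem_support_iff.2 hn)
    omega

lemma ore_aux (m : ℕ) : ∀ p ∈ L.poly, p ≠ 0 →
    (∃ b : ℤ, ∀ n, p.coeff n ≠ 0 → b ≤ n ∧ n < b + m) →
    ∀ q ∈ L.poly, ∃ r ∈ L.poly, ∃ s ∈ L.poly, r ≠ 0 ∧ r * q = s * p := by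
  induction m using Nat.strong_induction_on with
  | _ m ih =>
    rintro p hp hp0 ⟨b, hb⟩ q hq
    have hne : p.coeff.support.Nonempty := by
      rw [Finset.nonempty_iff_ne_empty, Ne, Finsupp.support_eq_empty]
      intro h
      exact hp0 (by ext n; rw [h]; rfl)
    have hmin := hb _ (Finsupp.mem_support_iff.1 (p.coeff.support.min'_mem hne))
    have hmax := hb _ (Finsupp.mem_support_iff.1 (p.coeff.support.max'_mem hne))
    have hle := Finset.min'_le_max' _ hne
    set lo := p.coeff.support.min' hne with hlo
    set hi := p.coeff.support.max' hne with hhi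
    obtain ⟨d, hd⟩ : ∃ d : ℕ, hi = lo + d := ⟨(hi - lo).toNat, by omega⟩
    obtain ⟨b₁, m₁, hq₁⟩ := exists_support_bounds q
    obtain ⟨s, hs, b', hb'⟩ := exists_sub_mul_support hp (a := lo) (d := d)
      (by rw [← hd]; exact Finsupp.mem_support_iff.1 (p.coeff.support.max'_mem hne))
      (fun n hn => by
        rw [← hd]
        exact ⟨Finset.min'_le _ n (Finsupp.mem_support_iff.2 hn),
          Finset.le_max' _ n (Finsupp.mem_support_iff.2 hn)⟩) m₁ b₁ q hq hq₁
    by_cases h0 : q - s * p = 0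
    · exact ⟨1, L.poly.one_mem, s, hs, one_ne_zero, by rw [one_mul, ← sub_eq_zero, h0]⟩
    obtain ⟨r', hr', s', hs', hr0, h⟩ := ih d (by omega) (q - s * p)
      (L.poly.sub_mem hq (L.poly.mul_mem hs hp)) h0 ⟨b', hb'⟩ p hp
    refine ⟨s', hs', r' + s' * s, L.poly.add_mem hr' (L.poly.mul_mem hs' hs), ?_, ?_⟩
    · rintro rfl
      rw [zero_mul] at h
      exact (mul_ne_zero hr0 hp0) h
    · rw [add_mul, h, mul_sub, mul_assoc]
      abel

/-- The left Ore condition for the twisted Laurent polynomial ring. -/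
lemma ore {p q : D[T;T⁻¹]} (hp : p ∈ L.poly) (hp0 : p ≠ 0) (hq : q ∈ L.poly) :
    ∃ r ∈ L.poly, ∃ s ∈ L.poly, r ≠ 0 ∧ r * q = s * p := by
  obtain ⟨b, m, h⟩ := exists_support_bounds p
  exact ore_aux m p hp hp0 ⟨b, h⟩ q hq

variable (L)

/-- The Laurent series `s` is an expansion of `x`: both are given by the same left fraction of
twisted Laurent polynomials. -/
def Expansion (x : D) (s : HahnSeries ℤ D) : Prop :=
  ∃ p ∈ L.poly, ∃ q ∈ L.poly, p ≠ 0 ∧ laurentAug D p * x = laurentAug D q ∧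
    laurentToSeries D p * s = laurentToSeries D q

variable {L}

lemma laurentAug_ne_zero {p : D[T;T⁻¹]} (hp : p ∈ L.poly) (hp0 : p ≠ 0) : laurentAug D p ≠ 0 :=
  fun h => hp0 (eq_zero_of_laurentAug_eq_zero hp h)

lemma laurentToSeries_ne_zero {p : D[T;T⁻¹]} (hp0 : p ≠ 0) : laurentToSeries D p ≠ 0 :=
  (map_ne_zero_iff _ (laurentToSeries_injective D)).2 hp0

lemma Expansion.eq_zero_iff {x : D} {s : HahnSeries ℤ D} (h : L.Expansion x s) :
    x = 0 ↔ s = 0 := by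
  obtain ⟨p, hp, q, hq, hp0, hx, hs⟩ := h
  constructor
  · rintro rfl
    rw [mul_zero] at hx
    rw [eq_zero_of_laurentAug_eq_zero hq hx.symm, map_zero] at hs
    exact (mul_eq_zero.1 hs).resolve_left (laurentToSeries_ne_zero hp0)
  · rintro rfl
    rw [mul_zero] at hs
    rw [laurentToSeries_injective D (hs.symm.trans (map_zero _).symm), map_zero] at hx
    exact (mul_eq_zero.1 hx).resolve_left (laurentAug_ne_zero hp hp0)

lemma Expansion.add {x y : D} {s t : HahnSeries ℤ D} (hx : L.Expansion x s)
    (hy : L.Expansion y t) : L.Expansion (x + y) (s + t) := by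
  obtain ⟨p, hp, q, hq, hp0, hx, hs⟩ := hx
  obtain ⟨p', hp', q', hq', hp0', hy, ht⟩ := hy
  obtain ⟨r, hr, r', hr', hr0, h⟩ := ore hp' hp0' hp
  refine ⟨r * p, L.poly.mul_mem hr hp, r * q + r' * q',
    L.poly.add_mem (L.poly.mul_mem hr hq) (L.poly.mul_mem hr' hq'), mul_ne_zero hr0 hp0, ?_, ?_⟩
  · rw [mul_add, map_add, map_mul _ r q, map_mul _ r' q', ← hx, ← hy, ← mul_assoc, ← map_mul,
      ← mul_assoc, ← map_mul, h]
  · rw [mul_add, map_add, map_mul _ r q, map_mul _ r' q', ← hs, ← ht, ← mul_assoc, ← map_mul,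
      ← mul_assoc, ← map_mul, h]

lemma Expansion.mul {x y : D} {s t : HahnSeries ℤ D} (hx : L.Expansion x s)
    (hy : L.Expansion y t) : L.Expansion (x * y) (s * t) := by
  obtain ⟨p, hp, q, hq, hp0, hx, hs⟩ := hx
  obtain ⟨p', hp', q', hq', hp0', hy, ht⟩ := hy
  obtain ⟨r, hr, r', hr', hr0, h⟩ := ore hp' hp0' hq
  refine ⟨r * p, L.poly.mul_mem hr hp, r' * q', L.poly.mul_mem hr' hq', mul_ne_zero hr0 hp0, ?_, ?_⟩
  · rw [map_mul _ r', ← hy, ← mul_assoc (laurentAug D r'), ← map_mul, ← h, map_mul, map_mul, ← hx]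
    simp only [mul_assoc]
  · rw [map_mul _ r', ← ht, ← mul_assoc (laurentToSeries D r'), ← map_mul, ← h, map_mul, map_mul, ← hs]
    simp only [mul_assoc]

lemma Expansion.inv {x : D} {s s' : HahnSeries ℤ D} (hx : L.Expansion x s) (h : s * s' = 1) :
    L.Expansion x⁻¹ s' := by
  have hs0 : s ≠ 0 := left_ne_zero_of_mul_eq_one h
  have hx0 : x ≠ 0 := fun h0 => hs0 (hx.eq_zero_iff.1 h0)
  obtain ⟨p, hp, q, hq, hp0, hx, hs⟩ := hx
  refine ⟨q, hq, p, hp, ?_, ?_, ?_⟩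
  · rintro rfl
    rw [map_zero] at hs
    exact mul_ne_zero (laurentToSeries_ne_zero hp0) hs0 hs
  · rw [← hx, mul_inv_cancel_right₀ hx0]
  · rw [← hs, mul_assoc, h, mul_one]

lemma Expansion.single {n : ℤ} {x : D} (hx : L.Homogeneous n x) :
    L.Expansion x (HahnSeries.single n x) :=
  ⟨1, L.poly.one_mem, AddMonoidAlgebra.single n x, single_mem_poly hx, one_ne_zero,
    by rw [map_one, one_mul, laurentAug_single],
    by rw [map_one, one_mul, laurentToSeries_single]⟩

end TwistedLaurentData

end TwistedLaurent

section HughesFree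

lemma ringZPow_eq_zpow {D : Type*} [DivisionRing D] (x : D) (i : ℤ) : ringZPow x i = x ^ i := by
  unfold ringZPow
  split_ifs with h
  · rw [← zpow_natCast, Int.toNat_of_nonneg h]
  · rw [Ring.inverse_eq_inv', inv_pow, ← zpow_natCast, Int.toNat_of_nonneg (by omega), zpow_neg,
      inv_inv]

lemma Subfield.closure_le_divisionClosure {D : Type*} [DivisionRing D] {s t : Set D}
    (h : s ⊆ t) : ((Subfield.closure s : Subfield D) : Set D) ⊆ divisionClosure t := by
  intro x hx
  refine Subring.mem_sInf.2 fun S hS => ?_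
  let F : Subfield D :=
    { S with
      inv_mem' := fun y hy => by
        by_cases hy0 : y = 0
        · rw [hy0, inv_zero]
          exact S.zero_mem
        · obtain ⟨z, hz, hyz, -⟩ := hS.1 y hy hy0
          rwa [inv_eq_of_mul_eq_one_right hyz] }
  exact (Subfield.closure_le (t := F)).2 (h.trans hS.2) hx

variable {k : Type*} [DivisionRing k] {G : Type*} [Group G]

lemma map_of_inv {D : Type*} [DivisionRing D] (φ : MonoidAlgebra k G →+* D) (g : G) :
    φ (MonoidAlgebra.of k G g⁻¹) = (φ (MonoidAlgebra.of k G g))⁻¹ := by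
  refine eq_inv_of_mul_eq_one_left ?_
  rw [← map_mul, ← map_mul, inv_mul_cancel, map_one, map_one]

lemma map_of_zpow {D : Type*} [DivisionRing D] (φ : MonoidAlgebra k G →+* D) (g : G) (n : ℤ) :
    φ (MonoidAlgebra.of k G (g ^ n)) = φ (MonoidAlgebra.of k G g) ^ n :=
  map_zpow' ((φ : MonoidAlgebra k G →* D).comp (MonoidAlgebra.of k G)) (map_of_inv φ) g n

lemma map_of_ne_zero {D : Type*} [DivisionRing D] (φ : MonoidAlgebra k G →+* D) (g : G) :
    φ (MonoidAlgebra.of k G g) ≠ 0 := by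
  refine left_ne_zero_of_mul_eq_one (b := φ (MonoidAlgebra.of k G g⁻¹)) ?_
  rw [← map_mul, ← map_mul, mul_inv_cancel, map_one, map_one]

/-- The division subring generated by the image of the group algebra of a subgroup. -/
def supportField {D : Type*} [DivisionRing D] (φ : MonoidAlgebra k G →+* D) (H : Subgroup G) :
    Subfield D :=
  Subfield.closure {y | ∃ g ∈ H, ∃ a : k, φ (MonoidAlgebra.single g a) = y}

lemma single_mem_supportField {D : Type*} [DivisionRing D] (φ : MonoidAlgebra k G →+* D)
    {H : Subgroup G} {g : G} (hg : g ∈ H) (a : k) :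
    φ (MonoidAlgebra.single g a) ∈ supportField φ H :=
  Subfield.subset_closure ⟨g, hg, a, rfl⟩

lemma supportField_mono {D : Type*} [DivisionRing D] (φ : MonoidAlgebra k G →+* D)
    {H K : Subgroup G} (h : H ≤ K) : supportField φ H ≤ supportField φ K :=
  Subfield.closure_mono fun _ ⟨g, hg, a, ha⟩ => ⟨g, h hg, a, ha⟩

lemma conj_mem_supportField {D : Type*} [DivisionRing D] (φ : MonoidAlgebra k G →+* D)
    {H : Subgroup G} {g : G} (hg : ∀ h ∈ H, g * h * g⁻¹ ∈ H) {x : D}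
    (hx : x ∈ supportField φ H) :
    φ (MonoidAlgebra.of k G g) * x * (φ (MonoidAlgebra.of k G g))⁻¹ ∈ supportField φ H := by
  have hu := map_of_ne_zero φ g
  have hui := map_of_inv φ g
  induction hx using Subfield.closure_induction with
  | mem x hx =>
    obtain ⟨h, hh, a, rfl⟩ := hx
    rw [← hui, ← map_mul, ← map_mul]
    simp only [MonoidAlgebra.of_apply, MonoidAlgebra.single_mul_single, one_mul, mul_one]
    exact single_mem_supportField φ (hg h hh) a
  | one =>
    rw [mul_one, mul_inv_cancel₀ hu]
    exact (supportField φ H).one_mem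
  | add x y _ _ hx hy =>
    rw [mul_add, add_mul]
    exact add_mem hx hy
  | neg x _ hx =>
    rw [mul_neg, neg_mul]
    exact neg_mem hx
  | inv x _ hx =>
    have := (supportField φ H).inv_mem hx
    rwa [mul_inv_rev, mul_inv_rev, inv_inv, ← mul_assoc] at this
  | mul x y _ _ hx hy =>
    have := mul_mem hx hy
    rwa [mul_assoc, mul_assoc, ← mul_assoc _⁻¹, ← mul_assoc _⁻¹, inv_mul_cancel₀ hu, one_mul,
      ← mul_assoc, ← mul_assoc, mul_assoc _ x] at this

/-- The twisted Laurent data attached to an indicable subgroup by Hughes-freeness. -/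
noncomputable def IsHughesFreeEmbedding.laurentData {D : Type*} [DivisionRing D]
    {φ : MonoidAlgebra k G →+* D} (hφ : IsHughesFreeEmbedding φ) {H : Subgroup G} (hH : H.FG)
    {f : H →* Multiplicative ℤ} (hf : Function.Surjective f) {t : H}
    (ht : f t = Multiplicative.ofAdd 1) : TwistedLaurentData D where
  K := supportField φ (f.ker.map H.subtype)
  τ := φ (MonoidAlgebra.of k G t)
  τ_ne_zero := map_of_ne_zero φ _
  conj_mem n d hd := by
    rw [zpow_neg, ← map_of_zpow]
    refine conj_mem_supportField φ ?_ hd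
    rintro _ ⟨h, hh, rfl⟩
    exact ⟨t ^ n * h * (t ^ n)⁻¹, f.normal_ker.conj_mem h hh _, rfl⟩
  indep c hc h0 := by
    refine hφ.2.2 H hH f.ker t ⟨f, hf, rfl, ht⟩ c (fun i => ?_) ?_
    · refine Subfield.closure_le_divisionClosure ?_ (hc i)
      rintro _ ⟨_, ⟨h, hh, rfl⟩, a, rfl⟩
      exact ⟨MonoidAlgebra.single ⟨h, hh⟩ a, by simp⟩
    · simp only [ringZPow_eq_zpow]
      exact h0

lemma IsHughesFreeEmbedding.laurentData_homogeneous {D : Type*} [DivisionRing D]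
    {φ : MonoidAlgebra k G →+* D} (hφ : IsHughesFreeEmbedding φ) {H : Subgroup G} (hH : H.FG)
    {f : H →* Multiplicative ℤ} (hf : Function.Surjective f) {t : H}
    (ht : f t = Multiplicative.ofAdd 1) (h : H) :
    (hφ.laurentData hH hf ht).Homogeneous (f h).toAdd (φ (MonoidAlgebra.of k G h)) := by
  change _ * φ (MonoidAlgebra.of k G t) ^ _ ∈ supportField φ (f.ker.map H.subtype)
  rw [← map_of_zpow, ← map_mul, ← map_mul]
  have hm : h * t ^ (-(f h).toAdd) ∈ f.ker := ?_
  · exact single_mem_supportField φ (Subgroup.mem_map_of_mem H.subtype hm) 1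
  change f _ = 1
  rw [map_mul, map_zpow, ht, ← ofAdd_zsmul]
  apply Multiplicative.toAdd.injective
  simp

end HughesFree

section Construction

variable {k : Type*} [DivisionRing k] {G : Type*} [Group G]
  {D₁ : Type*} [DivisionRing D₁] {D₂ : Type*} [DivisionRing D₂]
  (Φ : MonoidAlgebra k G →+* D₁ × D₂)

/-- The image of a group element. -/
noncomputable def grp (g : G) : D₁ × D₂ := Φ (MonoidAlgebra.of k G g)

lemma grp_mul (g h : G) : grp Φ (g * h) = grp Φ g * grp Φ h := by
  simp only [grp, map_mul]

lemma grp_one : grp Φ 1 = 1 := by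
  simp only [grp, map_one]

lemma grp_inv (g : G) : grp Φ g⁻¹ = (grp Φ g)⁻¹ :=
  eq_inv_of_mul_eq_one_left (by rw [← grp_mul, inv_mul_cancel, grp_one])

lemma grp_mul_inv (g : G) : grp Φ g * (grp Φ g)⁻¹ = 1 := by
  rw [← grp_inv, ← grp_mul, mul_inv_cancel, grp_one]

lemma grp_inv_mul (g : G) : (grp Φ g)⁻¹ * grp Φ g = 1 := by
  rw [← grp_inv, ← grp_mul, inv_mul_cancel, grp_one]

lemma grp_fst_ne_zero (g : G) : (grp Φ g).1 ≠ 0 := map_of_ne_zero ((RingHom.fst D₁ D₂).comp Φ) g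

lemma grp_snd_ne_zero (g : G) : (grp Φ g).2 ≠ 0 := map_of_ne_zero ((RingHom.snd D₁ D₂).comp Φ) g

/-- Elements produced by a normalized rational expression of weight `c` over the finitely
generated subgroup `H`. -/
inductive Built : Subgroup G → Weight → D₁ × D₂ → Prop
  | scalar (a : k) : Built ⊥ 1 (Φ (MonoidAlgebra.single 1 a))
  | add {H₁ H₂ : Subgroup G} {c₁ c₂ : Weight} {x y : D₁ × D₂} (hx : Built H₁ c₁ x)
      (hy : Built H₂ c₂ y) (u : G) :
      Built (H₁ ⊔ H₂ ⊔ Subgroup.zpowers u) (c₁ + c₂) (x + y * grp Φ u)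
  | mul {H₁ H₂ : Subgroup G} {c₁ c₂ : Weight} {x y : D₁ × D₂} (hx : Built H₁ c₁ x)
      (hy : Built H₂ c₂ y) : Built (H₁ ⊔ H₂) (Weight.mul c₁ c₂) (x * y)
  | inv {H : Subgroup G} {c : Weight} {x : D₁ × D₂} (hx : Built H c x) :
      Built H (Weight.exp c) x⁻¹

variable {Φ}

lemma Built.pos {H : Subgroup G} {c : Weight} {x : D₁ × D₂} (h : Built Φ H c x) : 0 < c := by
  induction h with
  | scalar a => exact Weight.one_pos
  | add _ _ u h₁ h₂ => exact add_pos h₁ h₂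
  | mul _ _ h₁ h₂ => exact Weight.mul_pos h₁ h₂
  | inv _ h => exact h.trans_le (Weight.le_exp _)

lemma Built.fg {H : Subgroup G} {c : Weight} {x : D₁ × D₂} (h : Built Φ H c x) : H.FG := by
  induction h with
  | scalar a => exact Subgroup.FG.bot
  | add _ _ u h₁ h₂ => exact (h₁.sup h₂).sup ⟨{u}, by simp [Subgroup.zpowers_eq_closure]⟩
  | mul _ _ h₁ h₂ => exact h₁.sup h₂
  | inv _ h => exact h

lemma grp_mul_scalar (g : G) (a : k) :
    grp Φ g * Φ (MonoidAlgebra.single 1 a) = Φ (MonoidAlgebra.single g a) := by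
  rw [grp, ← map_mul, MonoidAlgebra.of_apply, MonoidAlgebra.single_mul_single]
  simp

lemma scalar_mul_grp (g : G) (a : k) :
    Φ (MonoidAlgebra.single 1 a) * grp Φ g = Φ (MonoidAlgebra.single g a) := by
  rw [grp, ← map_mul, MonoidAlgebra.of_apply, MonoidAlgebra.single_mul_single]
  simp

lemma grp_conj_mul (g : G) (x y : D₁ × D₂) :
    grp Φ g * (x * y) * (grp Φ g)⁻¹ = grp Φ g * x * (grp Φ g)⁻¹ * (grp Φ g * y * (grp Φ g)⁻¹) := by
  rw [mul_assoc _ _ (grp Φ g * y * _), mul_assoc (grp Φ g) y, ← mul_assoc (grp Φ g)⁻¹,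
    grp_inv_mul, one_mul]
  simp only [mul_assoc]

lemma Built.conj {H : Subgroup G} {c : Weight} {x : D₁ × D₂} (h : Built Φ H c x) (g : G) :
    ∃ H', Built Φ H' c (grp Φ g * x * (grp Φ g)⁻¹) := by
  induction h with
  | scalar a =>
    refine ⟨⊥, ?_⟩
    rw [grp_mul_scalar, ← scalar_mul_grp, mul_assoc, grp_mul_inv, mul_one]
    exact .scalar a
  | @add _ _ _ _ x y _ _ u h₁ h₂ =>
    obtain ⟨H₁, h₁⟩ := h₁
    obtain ⟨H₂, h₂⟩ := h₂
    have h := h₁.add h₂ (g * u * g⁻¹)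
    rw [grp_mul, grp_mul, grp_inv, ← grp_conj_mul, ← add_mul, ← mul_add] at h
    exact ⟨_, h⟩
  | mul _ _ h₁ h₂ =>
    obtain ⟨H₁, h₁⟩ := h₁
    obtain ⟨H₂, h₂⟩ := h₂
    have h := h₁.mul h₂
    rw [← grp_conj_mul] at h
    exact ⟨_, h⟩
  | inv _ h =>
    obtain ⟨H, h⟩ := h
    refine ⟨H, ?_⟩
    have := h.inv
    rwa [mul_inv_rev, mul_inv_rev, inv_inv, ← mul_assoc] at this

lemma scalar_inv (a : k) :
    (Φ (MonoidAlgebra.single 1 a))⁻¹ = Φ (MonoidAlgebra.single 1 a⁻¹) := by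
  by_cases ha : a = 0
  · subst ha
    rw [inv_zero, MonoidAlgebra.single_zero, map_zero]
    exact Prod.ext inv_zero inv_zero
  · refine inv_eq_of_mul_eq_one_right ?_
    rw [← map_mul, MonoidAlgebra.single_mul_single, mul_one, mul_inv_cancel₀ ha]
    exact map_one Φ

lemma Built.eq_scalar {H : Subgroup G} {c : Weight} {x : D₁ × D₂} (h : Built Φ H c x)
    (hH : H = ⊥) : ∃ a : k, x = Φ (MonoidAlgebra.single 1 a) := by
  induction h with
  | scalar a => exact ⟨a, rfl⟩
  | add _ _ u h₁ h₂ =>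
    rw [sup_eq_bot_iff, sup_eq_bot_iff, Subgroup.zpowers_eq_bot] at hH
    obtain ⟨⟨hH₁, hH₂⟩, rfl⟩ := hH
    obtain ⟨a, rfl⟩ := h₁ hH₁
    obtain ⟨b, rfl⟩ := h₂ hH₂
    exact ⟨a + b, by rw [grp_one, mul_one, MonoidAlgebra.single_add, map_add]⟩
  | mul _ _ h₁ h₂ =>
    rw [sup_eq_bot_iff] at hH
    obtain ⟨a, rfl⟩ := h₁ hH.1
    obtain ⟨b, rfl⟩ := h₂ hH.2
    exact ⟨a * b, by rw [← map_mul, MonoidAlgebra.single_mul_single, mul_one]⟩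
  | inv _ h =>
    obtain ⟨a, rfl⟩ := h hH
    exact ⟨a⁻¹, scalar_inv a⟩

lemma Built.mem_supportField {H : Subgroup G} {c : Weight} {x : D₁ × D₂} (h : Built Φ H c x) :
    x.1 ∈ supportField ((RingHom.fst D₁ D₂).comp Φ) H ∧
      x.2 ∈ supportField ((RingHom.snd D₁ D₂).comp Φ) H := by
  induction h with
  | scalar a =>
    exact ⟨single_mem_supportField ((RingHom.fst D₁ D₂).comp Φ) (Subgroup.one_mem _) a,
      single_mem_supportField ((RingHom.snd D₁ D₂).comp Φ) (Subgroup.one_mem _) a⟩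
  | @add H₁ H₂ _ _ _ _ _ _ u h₁ h₂ =>
    have l₁ : H₁ ≤ H₁ ⊔ H₂ ⊔ Subgroup.zpowers u := le_sup_left.trans le_sup_left
    have l₂ : H₂ ≤ H₁ ⊔ H₂ ⊔ Subgroup.zpowers u := le_sup_right.trans le_sup_left
    have hu : u ∈ H₁ ⊔ H₂ ⊔ Subgroup.zpowers u :=
      (le_sup_right : _ ≤ H₁ ⊔ H₂ ⊔ Subgroup.zpowers u) (Subgroup.mem_zpowers u)
    exact ⟨add_mem (supportField_mono _ l₁ h₁.1) (mul_mem (supportField_mono _ l₂ h₂.1)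
        (single_mem_supportField _ hu 1)),
      add_mem (supportField_mono _ l₁ h₁.2) (mul_mem (supportField_mono _ l₂ h₂.2)
        (single_mem_supportField _ hu 1))⟩
  | mul _ _ h₁ h₂ =>
    exact ⟨mul_mem (supportField_mono _ le_sup_left h₁.1) (supportField_mono _ le_sup_right h₂.1),
      mul_mem (supportField_mono _ le_sup_left h₁.2) (supportField_mono _ le_sup_right h₂.2)⟩
  | inv _ h => exact ⟨inv_mem h.1, inv_mem h.2⟩

variable (Φ)

/-- Elements which are zero, or a normalized expression of weight at most `c` times a group
element. -/
def WeightLE (c : Weight) (x : D₁ × D₂) : Prop :=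
  x = 0 ∨ ∃ c' ≤ c, ∃ H y, ∃ u : G, Built Φ H c' y ∧ x = y * grp Φ u

variable {Φ}

lemma WeightLE.mono {c d : Weight} (h : c ≤ d) {x : D₁ × D₂} (hx : WeightLE Φ c x) :
    WeightLE Φ d x :=
  hx.imp_right fun ⟨c', hc, H, y, u, hy⟩ => ⟨c', hc.trans h, H, y, u, hy⟩

lemma WeightLE.zero (c : Weight) : WeightLE Φ c 0 := Or.inl rfl

lemma Built.weightLE {H : Subgroup G} {c : Weight} {x : D₁ × D₂} (h : Built Φ H c x) :
    WeightLE Φ c x :=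
  Or.inr ⟨c, le_rfl, H, x, 1, h, by rw [grp_one, mul_one]⟩

lemma WeightLE.mul_grp {c : Weight} {x : D₁ × D₂} (hx : WeightLE Φ c x) (g : G) :
    WeightLE Φ c (x * grp Φ g) := by
  rcases hx with rfl | ⟨c', hc, H, y, u, hy, rfl⟩
  · rw [MulZeroClass.zero_mul]
    exact .zero c
  · exact Or.inr ⟨c', hc, H, y, u * g, hy, by rw [grp_mul, mul_assoc]⟩

lemma weightLE_single (g : G) (a : k) : WeightLE Φ 1 (Φ (MonoidAlgebra.single g a)) := by
  rw [← scalar_mul_grp]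
  exact (Built.scalar a).weightLE.mul_grp g

lemma WeightLE.add {c d : Weight} {x y : D₁ × D₂} (hx : WeightLE Φ c x) (hy : WeightLE Φ d y) :
    WeightLE Φ (c + d) (x + y) := by
  rcases hx with rfl | ⟨c', hc, H, x, u, hx, rfl⟩
  · rw [zero_add]
    exact hy.mono (le_add_of_nonneg_left (Weight.zero_le c))
  rcases hy with rfl | ⟨d', hd, H', y, v, hy, rfl⟩
  · rw [add_zero]
    exact (hx.weightLE.mul_grp u).mono (hc.trans (le_add_of_nonneg_right (Weight.zero_le d)))
  refine Or.inr ⟨_, add_le_add hc hd, _, _, u, hx.add hy (v * u⁻¹), ?_⟩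
  rw [add_mul, mul_assoc y, ← grp_mul, inv_mul_cancel_right]

lemma WeightLE.mul {c d : Weight} {x y : D₁ × D₂} (hx : WeightLE Φ c x) (hy : WeightLE Φ d y) :
    WeightLE Φ (Weight.mul c d) (x * y) := by
  rcases hx with rfl | ⟨c', hc, H, x, u, hx, rfl⟩
  · rw [MulZeroClass.zero_mul]
    exact .zero _
  rcases hy with rfl | ⟨d', hd, H', y, v, hy, rfl⟩
  · rw [MulZeroClass.mul_zero]
    exact .zero _
  obtain ⟨H'', hy'⟩ := hy.conj u
  refine Or.inr ⟨_, Weight.mul_le_mul hc hd, _, _, u * v, hx.mul hy', ?_⟩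
  rw [grp_mul, mul_assoc, mul_assoc, mul_assoc, ← mul_assoc _⁻¹, grp_inv_mul, one_mul]
  simp only [mul_assoc]

lemma WeightLE.inv {c : Weight} {x : D₁ × D₂} (hx : WeightLE Φ c x) :
    WeightLE Φ (Weight.exp c) x⁻¹ := by
  rcases hx with rfl | ⟨c', hc, H, x, u, hx, rfl⟩
  · rw [show (0 : D₁ × D₂)⁻¹ = 0 from Prod.ext inv_zero inv_zero]
    exact .zero _
  obtain ⟨H', hx'⟩ := hx.inv.conj u⁻¹
  refine Or.inr ⟨_, Weight.exp_le_exp hc, _, _, u⁻¹, hx', ?_⟩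
  rw [mul_inv_rev, mul_assoc, ← grp_inv, mul_assoc, ← mul_assoc (grp Φ u⁻¹), grp_inv, inv_inv]
  rw [mul_assoc, grp_mul_inv, mul_one]

lemma WeightLE.neg {c : Weight} {x : D₁ × D₂} (hx : WeightLE Φ c x) :
    WeightLE Φ (Weight.mul 1 c) (-x) := by
  have h := (weightLE_single (Φ := Φ) 1 (-1)).mul hx
  rwa [MonoidAlgebra.single_neg, map_neg, ← MonoidAlgebra.one_def, map_one, neg_one_mul] at h

lemma WeightLE.sum {ι : Type*} (s : Finset ι) (γ : ι → Weight) (x : ι → D₁ × D₂)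
    (h : ∀ i ∈ s, WeightLE Φ (γ i) (x i)) : WeightLE Φ (∑ i ∈ s, γ i) (∑ i ∈ s, x i) := by
  classical
  induction s using Finset.induction_on with
  | empty => exact .zero _
  | insert i s hi ih =>
    rw [Finset.sum_insert hi, Finset.sum_insert hi]
    exact (h i (Finset.mem_insert_self i s)).add
      (ih fun j hj => h j (Finset.mem_insert_of_mem hj))

end Construction

section SeriesInverse

open HahnSeries in
/-- A Laurent series with invertible leading coefficient is invertible, and the coefficients of
the inverse lie in any subring containing the coefficients and the inverse leading coefficient. -/
lemma exists_series_mul_eq_one {R : Type*} [Ring R] (B : Subring R) (s : HahnSeries ℤ R) (u : Rˣ)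
    (hu : s.coeff s.order = u) (hB : ∀ n, s.coeff n ∈ B) (huB : (↑u⁻¹ : R) ∈ B) :
    ∃ s' : HahnSeries ℤ R, s * s' = 1 ∧ ∀ n, s'.coeff n ∈ B := by
  set p : PowerSeries R := PowerSeries.mk fun n => s.coeff (s.order + n) with hp
  have hp0 : PowerSeries.constantCoeff p = u := by
    rw [← PowerSeries.coeff_zero_eq_constantCoeff_apply, hp, PowerSeries.coeff_mk]
    simpa using hu
  have hsp : s = single s.order 1 * ofPowerSeries ℤ R p := by
    ext n
    have h := coeff_single_mul_add (r := (1 : R)) (x := ofPowerSeries ℤ R p) (a := n - s.order)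
      (b := s.order)
    rw [sub_add_cancel, one_mul] at h
    rw [h]
    by_cases hn : n < s.order
    · rw [coeff_eq_zero_of_lt_order hn, ofPowerSeries_apply, embDomain_of_notMem_range]
      rintro ⟨m, hm⟩
      simp at hm
      omega
    · obtain ⟨m, hm⟩ : ∃ m : ℕ, n = s.order + m := ⟨(n - s.order).toNat, by omega⟩
      rw [hm, add_sub_cancel_left, ofPowerSeries_apply_coeff, hp, PowerSeries.coeff_mk]
  have hq : ∀ n, PowerSeries.coeff n (PowerSeries.invOfUnit p u) ∈ B := by
    intro n
    induction n using Nat.strong_induction_on with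
    | _ n ih =>
      rw [PowerSeries.coeff_invOfUnit]
      split_ifs with h
      · exact huB
      · rw [neg_mul]
        refine B.neg_mem (B.mul_mem huB (B.sum_mem fun ij _ => ?_))
        split_ifs with h'
        · refine B.mul_mem ?_ (ih _ h')
          rw [hp, PowerSeries.coeff_mk]
          exact hB _
        · exact B.zero_mem
  refine ⟨ofPowerSeries ℤ R (PowerSeries.invOfUnit p u) * single (-s.order) 1, ?_, fun n => ?_⟩
  · refine (congrArg (· * _) hsp).trans ?_
    rw [mul_assoc, ← mul_assoc (ofPowerSeries ℤ R p), ← map_mul,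
      PowerSeries.mul_invOfUnit _ _ hp0, RingHom.map_one, one_mul, single_mul_single, add_neg_cancel,
      one_mul]
    rfl
  · have h := coeff_mul_single_add (r := (1 : R))
      (x := ofPowerSeries ℤ R (PowerSeries.invOfUnit p u)) (a := n + s.order) (b := -s.order)
    rw [add_neg_cancel_right, mul_one] at h
    rw [h]
    by_cases hn : n + s.order < 0
    · rw [ofPowerSeries_apply, embDomain_of_notMem_range]
      · exact B.zero_mem
      · rintro ⟨m, hm⟩
        simp at hm
        omega
    · obtain ⟨m, hm⟩ : ∃ m : ℕ, n + s.order = m := ⟨(n + s.order).toNat, by omega⟩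
      rw [hm, ofPowerSeries_apply_coeff]
      exact hq m

end SeriesInverse

section PairExpansion

variable {D₁ : Type*} [DivisionRing D₁] {D₂ : Type*} [DivisionRing D₂]

/-- Componentwise expansion into Laurent series. -/
def PairExpansion (L₁ : TwistedLaurentData D₁) (L₂ : TwistedLaurentData D₂) (x : D₁ × D₂)
    (s : HahnSeries ℤ (D₁ × D₂)) : Prop :=
  L₁.Expansion x.1 (s.map (RingHom.fst D₁ D₂)) ∧ L₂.Expansion x.2 (s.map (RingHom.snd D₁ D₂))

variable {L₁ : TwistedLaurentData D₁} {L₂ : TwistedLaurentData D₂}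

lemma series_map_add {R S : Type*} [Ring R] [Ring S] (f : R →+* S) (s t : HahnSeries ℤ R) :
    (s + t).map f = s.map f + t.map f := by
  ext n
  simp

lemma series_map_mul {R S : Type*} [Ring R] [Ring S] (f : R →+* S) (s t : HahnSeries ℤ R) :
    (s * t).map f = s.map f * t.map f :=
  HahnSeries.map_mul (f : R →ₙ+* S)

lemma series_map_one {R S : Type*} [Ring R] [Ring S] (f : R →+* S) :
    (1 : HahnSeries ℤ R).map f = 1 := by
  ext n
  simp [HahnSeries.coeff_one, apply_ite f]

lemma series_map_single {R S : Type*} [Ring R] [Ring S] (f : R →+* S) (n : ℤ) (x : R) :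
    (HahnSeries.single n x).map f = HahnSeries.single n (f x) := by
  ext m
  simp [HahnSeries.coeff_single, apply_ite f]

lemma PairExpansion.add {x y : D₁ × D₂} {s t : HahnSeries ℤ (D₁ × D₂)}
    (hx : PairExpansion L₁ L₂ x s) (hy : PairExpansion L₁ L₂ y t) :
    PairExpansion L₁ L₂ (x + y) (s + t) := by
  constructor
  · rw [series_map_add]
    exact hx.1.add hy.1
  · rw [series_map_add]
    exact hx.2.add hy.2

lemma PairExpansion.mul {x y : D₁ × D₂} {s t : HahnSeries ℤ (D₁ × D₂)}
    (hx : PairExpansion L₁ L₂ x s) (hy : PairExpansion L₁ L₂ y t) :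
    PairExpansion L₁ L₂ (x * y) (s * t) := by
  constructor
  · rw [series_map_mul]
    exact hx.1.mul hy.1
  · rw [series_map_mul]
    exact hx.2.mul hy.2

lemma PairExpansion.inv {x : D₁ × D₂} {s s' : HahnSeries ℤ (D₁ × D₂)}
    (hx : PairExpansion L₁ L₂ x s) (h : s * s' = 1) : PairExpansion L₁ L₂ x⁻¹ s' :=
  ⟨hx.1.inv (by rw [← series_map_mul, h, series_map_one]),
    hx.2.inv (by rw [← series_map_mul, h, series_map_one])⟩

lemma PairExpansion.single {x : D₁ × D₂} {n : ℤ} (h₁ : L₁.Homogeneous n x.1)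
    (h₂ : L₂.Homogeneous n x.2) : PairExpansion L₁ L₂ x (HahnSeries.single n x) := by
  constructor
  · rw [series_map_single]
    exact .single h₁
  · rw [series_map_single]
    exact .single h₂

lemma PairExpansion.eq_zero {x : D₁ × D₂} (h : PairExpansion L₁ L₂ x 0) : x = 0 := by
  refine Prod.ext (h.1.eq_zero_iff.2 ?_) (h.2.eq_zero_iff.2 ?_) <;> · ext n; simp

end PairExpansion

section Domination

variable {k : Type*} [DivisionRing k] {G : Type*} [Group G]
  {D₁ : Type*} [DivisionRing D₁] {D₂ : Type*} [DivisionRing D₂]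
  (Φ : MonoidAlgebra k G →+* D₁ × D₂)

/-- The coefficients of the series `s` have weights bounded by `γ`, whose finite sums are bounded
by `c`. -/
structure Dominated (s : HahnSeries ℤ (D₁ × D₂)) (γ : ℤ → Weight) (c : Weight) : Prop where
  coeff : ∀ n, WeightLE Φ (γ n) (s.coeff n)
  sum_le : ∀ S : Finset ℤ, ∑ n ∈ S, γ n ≤ c

variable {Φ}

lemma Dominated.le {s : HahnSeries ℤ (D₁ × D₂)} {γ : ℤ → Weight} {c : Weight}
    (h : Dominated Φ s γ c) (n : ℤ) : γ n ≤ c := by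
  simpa using h.sum_le {n}

lemma Dominated.sum_comp_le {s : HahnSeries ℤ (D₁ × D₂)} {γ : ℤ → Weight} {c : Weight}
    (h : Dominated Φ s γ c) {ι : Type*} (S : Finset ι) {e : ι → ℤ} (he : Set.InjOn e S) :
    ∑ i ∈ S, γ (e i) ≤ c := by
  classical
  rw [← Finset.sum_image (f := γ) he]
  exact h.sum_le _

lemma Dominated.add_shift {s t : HahnSeries ℤ (D₁ × D₂)} {γ δ : ℤ → Weight} {c d : Weight}
    (hs : Dominated Φ s γ c) (ht : Dominated Φ t δ d) (m : ℤ) (u : G) :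
    Dominated Φ (s + t * HahnSeries.single m (grp Φ u)) (fun n => γ n + δ (n - m)) (c + d) where
  coeff n := by
    have h := HahnSeries.coeff_mul_single_add (r := grp Φ u) (x := t) (a := n - m) (b := m)
    rw [sub_add_cancel] at h
    rw [HahnSeries.coeff_add, h]
    exact (hs.coeff n).add ((ht.coeff _).mul_grp u)
  sum_le S := by
    rw [Finset.sum_add_distrib]
    exact add_le_add (hs.sum_le S) (ht.sum_comp_le S fun a _ b _ h => sub_left_injective h)

/-- The bound for the coefficients of a product of two series. -/
noncomputable def mulBound (s t : HahnSeries ℤ (D₁ × D₂)) (γ δ : ℤ → Weight) (n : ℤ) : Weight :=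
  ∑ ij ∈ Finset.antidiagonal s.isPWO_support t.isPWO_support n,
    Weight.mul (γ ij.1) (δ ij.2)

lemma sum_mulBound_le (s t : HahnSeries ℤ (D₁ × D₂)) {γ δ : ℤ → Weight} {c d : Weight}
    (hγ : ∀ S : Finset ℤ, ∑ n ∈ S, γ n ≤ c) (hδ : ∀ S : Finset ℤ, ∑ n ∈ S, δ n ≤ d)
    (S : Finset ℤ) : ∑ n ∈ S, mulBound s t γ δ n ≤ Weight.mul c d := by
  classical
  unfold mulBound
  rw [← Finset.sum_biUnion]
  · set A := S.biUnion fun n => Finset.antidiagonal s.isPWO_support t.isPWO_support n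
    have hA : A ⊆ A.image Prod.fst ×ˢ A.image Prod.snd := fun ij h =>
      Finset.mem_product.2 ⟨Finset.mem_image_of_mem _ h, Finset.mem_image_of_mem _ h⟩
    exact ((Finset.sum_le_sum_of_subset_of_nonneg hA fun _ _ _ => Weight.zero_le _).trans
      (Weight.sum_sum_mul_le _ _ γ δ)).trans (Weight.mul_le_mul (hγ _) (hδ _))
  · intro m _ n _ hmn
    refine Finset.disjoint_left.2 fun ij h h' => hmn ?_
    rw [Finset.mem_antidiagonal] at h h'
    exact h.2.2.symm.trans h'.2.2

lemma Dominated.mul {s t : HahnSeries ℤ (D₁ × D₂)} {γ δ : ℤ → Weight} {c d : Weight}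
    (hs : Dominated Φ s γ c) (ht : Dominated Φ t δ d) :
    Dominated Φ (s * t) (mulBound s t γ δ) (Weight.mul c d) where
  coeff n := by
    rw [HahnSeries.coeff_mul]
    exact WeightLE.sum _ _ _ fun ij _ => (hs.coeff _).mul (ht.coeff _)
  sum_le := sum_mulBound_le s t hs.sum_le ht.sum_le

lemma Dominated.mulBound_lt_of_right {s t : HahnSeries ℤ (D₁ × D₂)} {γ δ : ℤ → Weight}
    {c d : Weight} (hs : Dominated Φ s γ c) (hc : 0 < c) (hd : 0 < d) (h : ∀ n, δ n < d) (n : ℤ) :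
    mulBound s t γ δ n < Weight.mul c d := by
  unfold mulBound
  set A := Finset.antidiagonal s.isPWO_support t.isPWO_support n with hA
  rcases A.eq_empty_or_nonempty with h0 | h0
  · rw [h0, Finset.sum_empty]
    exact Weight.mul_pos hc hd
  obtain ⟨m, -, hm⟩ := A.exists_max_image (fun ij => δ ij.2) h0
  have hinj : Set.InjOn Prod.fst (A : Set (ℤ × ℤ)) := by
    intro a ha b hb hab
    rw [hA, Finset.mem_coe, Finset.mem_antidiagonal] at ha hb
    exact Prod.ext hab (by omega)
  calc ∑ ij ∈ A, Weight.mul (γ ij.1) (δ ij.2)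
      ≤ ∑ ij ∈ A, Weight.mul (γ ij.1) (δ m.2) :=
        Finset.sum_le_sum fun ij hij => Weight.mul_le_mul le_rfl (hm ij hij)
    _ ≤ Weight.mul (∑ ij ∈ A, γ ij.1) (δ m.2) := Weight.sum_mul_le _ _ _
    _ ≤ Weight.mul c (δ m.2) := Weight.mul_le_mul (hs.sum_comp_le A hinj) le_rfl
    _ < Weight.mul c d := Weight.mul_lt_left (h _) hc

lemma Dominated.mulBound_lt_of_left {s t : HahnSeries ℤ (D₁ × D₂)} {γ δ : ℤ → Weight}
    {c d : Weight} (ht : Dominated Φ t δ d) (hc : 0 < c) (hd : 0 < d) (h : ∀ n, γ n < c) (n : ℤ) :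
    mulBound s t γ δ n < Weight.mul c d := by
  unfold mulBound
  set A := Finset.antidiagonal s.isPWO_support t.isPWO_support n with hA
  rcases A.eq_empty_or_nonempty with h0 | h0
  · rw [h0, Finset.sum_empty]
    exact Weight.mul_pos hc hd
  obtain ⟨m, -, hm⟩ := A.exists_max_image (fun ij => γ ij.1) h0
  have hinj : Set.InjOn Prod.snd (A : Set (ℤ × ℤ)) := by
    intro a ha b hb hab
    rw [hA, Finset.mem_coe, Finset.mem_antidiagonal] at ha hb
    exact Prod.ext (by omega) hab
  calc ∑ ij ∈ A, Weight.mul (γ ij.1) (δ ij.2)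
      ≤ ∑ ij ∈ A, Weight.mul (γ m.1) (δ ij.2) :=
        Finset.sum_le_sum fun ij hij => Weight.mul_le_mul (hm ij hij) le_rfl
    _ ≤ Weight.mul (γ m.1) (∑ ij ∈ A, δ ij.2) := Weight.mul_sum_le _ _ _
    _ ≤ Weight.mul (γ m.1) d := Weight.mul_le_mul le_rfl (ht.sum_comp_le A hinj)
    _ < Weight.mul c d := Weight.mul_lt_right (h _) hd

variable (Φ) in
/-- The elements of weight less than `exp c`. -/
def smallSubring {c : Weight} (hc : 0 < c) : Subring (D₁ × D₂) where
  carrier := {x | ∃ d < Weight.exp c, WeightLE Φ d x}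
  zero_mem' := ⟨0, Weight.one_pos.trans (Weight.one_lt_exp hc), .zero _⟩
  one_mem' := ⟨1, Weight.one_lt_exp hc, by
    have h := weightLE_single (Φ := Φ) 1 1
    rwa [← MonoidAlgebra.one_def, map_one] at h⟩
  add_mem' := fun ⟨_, hd, hx⟩ ⟨_, he, hy⟩ => ⟨_, Weight.add_lt_exp hd he, hx.add hy⟩
  mul_mem' := fun ⟨_, hd, hx⟩ ⟨_, he, hy⟩ => ⟨_, Weight.mul_lt_exp hd he, hx.mul hy⟩
  neg_mem' := fun ⟨_, hd, hx⟩ => ⟨_, Weight.mul_lt_exp (Weight.one_lt_exp hc) hd, hx.neg⟩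

lemma Dominated.exists_inv {s : HahnSeries ℤ (D₁ × D₂)} {γ : ℤ → Weight} {c : Weight}
    (h : Dominated Φ s γ c) (hc : 0 < c) (hγ : ∀ n, γ n < c) (hs : s ≠ 0)
    (hZ : ∀ d < c, ∀ x, WeightLE Φ d x → (x.1 = 0 ↔ x.2 = 0)) :
    ∃ s' δ, s * s' = 1 ∧ Dominated Φ s' δ (Weight.exp c) ∧ ∀ n, δ n < Weight.exp c := by
  have ha := h.coeff s.order
  have ha0 : s.coeff s.order ≠ 0 := HahnSeries.coeff_order_eq_zero.not.2 hs
  have hiff := hZ _ (hγ _) _ ha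
  have h1 : (s.coeff s.order).1 ≠ 0 := fun h0 => ha0 (Prod.ext h0 (hiff.1 h0))
  have h2 : (s.coeff s.order).2 ≠ 0 := fun h0 => ha0 (Prod.ext (hiff.2 h0) h0)
  let u : (D₁ × D₂)ˣ := ⟨s.coeff s.order, (s.coeff s.order)⁻¹,
    Prod.ext (mul_inv_cancel₀ h1) (mul_inv_cancel₀ h2),
    Prod.ext (inv_mul_cancel₀ h1) (inv_mul_cancel₀ h2)⟩
  obtain ⟨s', hss', hs'⟩ := exists_series_mul_eq_one (smallSubring Φ hc) s u rfl
    (fun n => ⟨_, (hγ n).trans_le (Weight.le_exp c), h.coeff n⟩)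
    ⟨_, Weight.exp_lt_exp (hγ _), ha.inv⟩
  choose δ hδ hw using hs'
  exact ⟨s', δ, hss', ⟨hw, fun S => (Weight.sum_lt_exp hc S δ fun i _ => hδ i).le⟩, hδ⟩

end Domination

section Uniqueness

variable {k : Type*} [DivisionRing k] {G : Type*} [Group G]
  {D₁ : Type*} [DivisionRing D₁] {D₂ : Type*} [DivisionRing D₂]
  {Φ : MonoidAlgebra k G →+* D₁ × D₂}

/-- Every normalized expression over `H` expands into a pair of Laurent series whose coefficients
have controlled weights. -/
lemma Built.exists_expansion {L₁ : TwistedLaurentData D₁} {L₂ : TwistedLaurentData D₂}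
    {H K : Subgroup G} {deg : G → ℤ}
    (hdeg₁ : ∀ u ∈ H, L₁.Homogeneous (deg u) (grp Φ u).1)
    (hdeg₂ : ∀ u ∈ H, L₂.Homogeneous (deg u) (grp Φ u).2)
    (hK₁ : supportField ((RingHom.fst D₁ D₂).comp Φ) K ≤ L₁.K)
    (hK₂ : supportField ((RingHom.snd D₁ D₂).comp Φ) K ≤ L₂.K)
    (hK : ∀ u ∈ H, deg u = 0 → u ∈ K) {C : Weight}
    (hZ : ∀ d < C, ∀ x, WeightLE Φ d x → (x.1 = 0 ↔ x.2 = 0))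
    {H' : Subgroup G} {c : Weight} {x : D₁ × D₂} (h : Built Φ H' c x) (hc : c ≤ C) (hH : H' ≤ H) :
    ∃ s γ, PairExpansion L₁ L₂ x s ∧ Dominated Φ s γ c ∧ (H' ≤ K → ∀ n ≠ 0, γ n = 0) ∧
      (¬ H' ≤ K → ∀ n, γ n < c) := by
  have kernel : ∀ {H' : Subgroup G} {c : Weight} {x : D₁ × D₂}, Built Φ H' c x → H' ≤ K →
      ∃ s γ, PairExpansion L₁ L₂ x s ∧ Dominated Φ s γ c ∧ (H' ≤ K → ∀ n ≠ 0, γ n = 0) ∧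
        (¬ H' ≤ K → ∀ n, γ n < c) := by
    intro H' c x h hH'
    have hx := h.mem_supportField
    refine ⟨HahnSeries.single 0 x, fun n => if n = 0 then c else 0, .single ?_ ?_, ⟨fun n => ?_,
      fun S => ?_⟩, fun _ n hn => if_neg hn, fun h => absurd hH' h⟩
    · simpa [TwistedLaurentData.Homogeneous] using hK₁ (supportField_mono _ hH' hx.1)
    · simpa [TwistedLaurentData.Homogeneous] using hK₂ (supportField_mono _ hH' hx.2)
    · rw [HahnSeries.coeff_single]
      split_ifs
      · exact h.weightLE
      · exact .zero _
    · rw [Finset.sum_ite_eq']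
      split_ifs
      · exact le_rfl
      · exact Weight.zero_le c
  induction h with
  | scalar a => exact kernel (.scalar a) bot_le
  | @add H₁ H₂ c₁ c₂ x y hx hy u ih₁ ih₂ =>
    by_cases hHK : H₁ ⊔ H₂ ⊔ Subgroup.zpowers u ≤ K
    · exact kernel (hx.add hy u) hHK
    have hu : u ∈ H := hH ((le_sup_right : _ ≤ H₁ ⊔ H₂ ⊔ _) (Subgroup.mem_zpowers u))
    have hc₁ : c₁ ≤ c₁ + c₂ := le_add_of_nonneg_right (Weight.zero_le _)
    have hc₂ : c₂ ≤ c₁ + c₂ := le_add_of_nonneg_left (Weight.zero_le _)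
    obtain ⟨s, γ, hs, hγ, hγ0, hγlt⟩ := ih₁ (hc₁.trans hc) ((le_sup_left.trans le_sup_left).trans hH)
    obtain ⟨t, δ, ht, hδ, hδ0, hδlt⟩ := ih₂ (hc₂.trans hc)
      ((le_sup_right.trans le_sup_left).trans hH)
    refine ⟨_, _, hs.add (ht.mul (.single (hdeg₁ u hu) (hdeg₂ u hu))), hγ.add_shift hδ (deg u) u,
      fun h => absurd h hHK, fun _ n => ?_⟩
    by_cases h₁ : H₁ ≤ K
    · by_cases h₂ : H₂ ≤ K
      · have hu0 : deg u ≠ 0 := fun h0 => hHK (sup_le (sup_le h₁ h₂)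
          (Subgroup.zpowers_le.2 (hK u hu h0)))
        by_cases hn : n = 0
        · rw [hδ0 h₂ (n - deg u) (by omega), add_zero]
          exact (hγ.le n).trans_lt (lt_add_of_pos_right _ hy.pos)
        · rw [hγ0 h₁ n hn, zero_add]
          exact (hδ.le _).trans_lt (lt_add_of_pos_left _ hx.pos)
      · exact add_lt_add_of_le_of_lt (hγ.le n) (hδlt h₂ _)
    · exact add_lt_add_of_lt_of_le (hγlt h₁ n) (hδ.le _)
  | @mul H₁ H₂ c₁ c₂ x y hx hy ih₁ ih₂ =>
    by_cases hHK : H₁ ⊔ H₂ ≤ K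
    · exact kernel (hx.mul hy) hHK
    obtain ⟨s, γ, hs, hγ, -, hγlt⟩ := ih₁ ((Weight.le_mul_right hy.pos).trans hc)
      (le_sup_left.trans hH)
    obtain ⟨t, δ, ht, hδ, -, hδlt⟩ := ih₂ ((Weight.le_mul_left hx.pos).trans hc)
      (le_sup_right.trans hH)
    refine ⟨_, _, hs.mul ht, hγ.mul hδ, fun h => absurd h hHK, fun _ => ?_⟩
    by_cases h₁ : H₁ ≤ K
    · exact hγ.mulBound_lt_of_right hx.pos hy.pos (hδlt fun h₂ => hHK (sup_le h₁ h₂))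
    · exact hδ.mulBound_lt_of_left hx.pos hy.pos (hγlt h₁)
  | @inv H₁ c₁ x hx ih =>
    by_cases hHK : H₁ ≤ K
    · exact kernel hx.inv hHK
    have hc₁ := (Weight.le_exp c₁).trans hc
    obtain ⟨s, γ, hs, hγ, -, hγlt⟩ := ih hc₁ hH
    by_cases hs0 : s = 0
    · subst hs0
      obtain rfl := hs.eq_zero
      have hexp := Weight.zero_le (Weight.exp c₁)
      rw [show (0 : D₁ × D₂)⁻¹ = 0 from Prod.ext inv_zero inv_zero]
      exact ⟨0, fun _ => 0, hs, ⟨fun n => .zero _, fun S => by simpa using hexp⟩,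
        fun _ _ _ => rfl, fun _ _ => hx.inv.pos⟩
    · obtain ⟨s', δ, hss', hδ, hδlt⟩ := hγ.exists_inv hx.pos (hγlt hHK) hs0
        fun d hd => hZ d (hd.trans_le hc₁)
      exact ⟨s', δ, hs.inv hss', hδ, fun h => absurd h hHK, fun _ => hδlt⟩

lemma scalar_fst_eq_zero_iff (a : k) : (Φ (MonoidAlgebra.single 1 a)).1 = 0 ↔
    (Φ (MonoidAlgebra.single 1 a)).2 = 0 := by
  by_cases ha : a = 0
  · simp [ha]
  · have h : Φ (MonoidAlgebra.single 1 a) * Φ (MonoidAlgebra.single 1 a⁻¹) = 1 := by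
      rw [← map_mul, MonoidAlgebra.single_mul_single, mul_one, mul_inv_cancel₀ ha]
      exact map_one Φ
    exact iff_of_false (left_ne_zero_of_mul_eq_one (congrArg Prod.fst h))
      (left_ne_zero_of_mul_eq_one (congrArg Prod.snd h))

/-- A rational expression vanishes in one Hughes-free division ring if and only if it vanishes in
the other. -/
lemma WeightLE.fst_eq_zero_iff (hG : LocallyIndicable G)
    (h₁ : IsHughesFreeEmbedding ((RingHom.fst D₁ D₂).comp Φ))
    (h₂ : IsHughesFreeEmbedding ((RingHom.snd D₁ D₂).comp Φ)) (c : Weight) :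
    ∀ x, WeightLE Φ c x → (x.1 = 0 ↔ x.2 = 0) := by
  induction c using WellFoundedLT.induction with
  | _ c ih =>
    rintro x (rfl | ⟨c', hc, H, y, u, hy, rfl⟩)
    · exact iff_of_true rfl rfl
    have hu₁ := grp_fst_ne_zero Φ u
    have hu₂ := grp_snd_ne_zero Φ u
    rw [Prod.fst_mul, Prod.snd_mul, mul_eq_zero_iff_right hu₁, mul_eq_zero_iff_right hu₂]
    by_cases hH : H = ⊥
    · obtain ⟨a, rfl⟩ := hy.eq_scalar hH
      exact scalar_fst_eq_zero_iff a
    obtain ⟨f, hf⟩ := hG H hH hy.fg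
    obtain ⟨t, ht⟩ := hf (Multiplicative.ofAdd 1)
    classical
    let deg : G → ℤ := fun g => if hg : g ∈ H then (f ⟨g, hg⟩).toAdd else 0
    have hHK : ¬ H ≤ f.ker.map H.subtype := by
      intro hle
      obtain ⟨t', ht', htt⟩ := hle t.2
      obtain rfl : t' = t := Subtype.ext htt
      have h1 : f t' = 1 := ht'
      rw [ht] at h1
      exact one_ne_zero (Multiplicative.ofAdd.injective h1)
    obtain ⟨s, γ, hs, hγ, -, hlt⟩ := hy.exists_expansion (L₁ := h₁.laurentData hy.fg hf ht)
      (L₂ := h₂.laurentData hy.fg hf ht) (H := H) (K := f.ker.map H.subtype) (deg := deg)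
      (fun g hg => by
        simp only [deg, dif_pos hg]
        exact h₁.laurentData_homogeneous hy.fg hf ht ⟨g, hg⟩)
      (fun g hg => by
        simp only [deg, dif_pos hg]
        exact h₂.laurentData_homogeneous hy.fg hf ht ⟨g, hg⟩)
      le_rfl le_rfl
      (fun g hg h0 => by
        simp only [deg, dif_pos hg] at h0
        have hm : (⟨g, hg⟩ : H) ∈ f.ker := Multiplicative.toAdd.injective h0
        exact Subgroup.mem_map_of_mem H.subtype hm)
      (C := c) ih hc le_rfl
    rw [hs.1.eq_zero_iff, hs.2.eq_zero_iff, HahnSeries.ext_iff, HahnSeries.ext_iff,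
      funext_iff, funext_iff]
    exact forall_congr' fun n => ih _ ((hlt hHK n).trans_le hc) _ (hγ.coeff n)

variable (Φ) in
/-- The ring of all values of rational expressions. -/
def valueRing : Subring (D₁ × D₂) where
  carrier := {x | ∃ c, WeightLE Φ c x}
  zero_mem' := ⟨0, .zero _⟩
  one_mem' := ⟨1, by
    have h := weightLE_single (Φ := Φ) 1 1
    rwa [← MonoidAlgebra.one_def, map_one] at h⟩
  add_mem' := fun ⟨_, hx⟩ ⟨_, hy⟩ => ⟨_, hx.add hy⟩
  mul_mem' := fun ⟨_, hx⟩ ⟨_, hy⟩ => ⟨_, hx.mul hy⟩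
  neg_mem' := fun ⟨_, hx⟩ => ⟨_, hx.neg⟩

lemma map_mem_valueRing (y : MonoidAlgebra k G) : Φ y ∈ valueRing Φ := by
  induction y using MonoidAlgebra.induction_linear with
  | zero => rw [map_zero]; exact zero_mem _
  | add y z hy hz => rw [map_add]; exact add_mem hy hz
  | single g a => exact ⟨1, weightLE_single g a⟩

lemma inv_mem_valueRing {x : D₁ × D₂} (hx : x ∈ valueRing Φ) : x⁻¹ ∈ valueRing Φ :=
  let ⟨_, hc⟩ := hx
  ⟨_, hc.inv⟩

lemma surjective_comp_valueRing {D : Type*} [DivisionRing D] (π : D₁ × D₂ →+* D)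
    (hπ : ∀ x, π x⁻¹ = (π x)⁻¹) (h : divisionClosure (Set.range (π.comp Φ)) = ⊤) :
    Function.Surjective (π.comp (valueRing Φ).subtype) := by
  intro z
  have hz : z ∈ divisionClosure (Set.range (π.comp Φ)) := h ▸ Subring.mem_top z
  refine Subring.mem_sInf.1 hz (π.comp (valueRing Φ).subtype).range ⟨?_, ?_⟩
  · rintro _ ⟨x, rfl⟩ hx0
    refine ⟨_, ⟨⟨x⁻¹, inv_mem_valueRing x.2⟩, rfl⟩, ?_⟩
    change π x * π (x : D₁ × D₂)⁻¹ = 1 ∧ π (x : D₁ × D₂)⁻¹ * π x = 1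
    rw [hπ]
    exact ⟨mul_inv_cancel₀ hx0, inv_mul_cancel₀ hx0⟩
  · rintro _ ⟨y, rfl⟩
    exact ⟨⟨Φ y, map_mem_valueRing y⟩, rfl⟩

/-- Hughes' theorem: Hughes-free division rings of fractions of a group algebra of a locally
indicable group are unique. -/
theorem IsHughesFreeEmbedding.exists_ringEquiv (hG : LocallyIndicable G)
    {φ₁ : MonoidAlgebra k G →+* D₁} {φ₂ : MonoidAlgebra k G →+* D₂}
    (h₁ : IsHughesFreeEmbedding φ₁) (h₂ : IsHughesFreeEmbedding φ₂) :
    ∃ e : D₁ ≃+* D₂, ∀ y, e (φ₁ y) = φ₂ y := by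
  set Φ : MonoidAlgebra k G →+* D₁ × D₂ := φ₁.prod φ₂
  have e₁ : (RingHom.fst D₁ D₂).comp Φ = φ₁ := rfl
  have e₂ : (RingHom.snd D₁ D₂).comp Φ = φ₂ := rfl
  have hZ : ∀ x ∈ valueRing Φ, (x.1 = 0 ↔ x.2 = 0) := fun x ⟨c, hc⟩ =>
    hc.fst_eq_zero_iff hG (e₁ ▸ h₁) (e₂ ▸ h₂) c x
  have b₁ : Function.Bijective ((RingHom.fst D₁ D₂).comp (valueRing Φ).subtype) := by
    refine ⟨(injective_iff_map_eq_zero _).2 fun x hx => ?_,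
      surjective_comp_valueRing _ (fun _ => rfl) (e₁ ▸ h₁.2.1)⟩
    exact Subtype.ext (Prod.ext hx ((hZ x x.2).1 hx))
  have b₂ : Function.Bijective ((RingHom.snd D₁ D₂).comp (valueRing Φ).subtype) := by
    refine ⟨(injective_iff_map_eq_zero _).2 fun x hx => ?_,
      surjective_comp_valueRing _ (fun _ => rfl) (e₂ ▸ h₂.2.1)⟩
    exact Subtype.ext (Prod.ext ((hZ x x.2).2 hx) hx)
  refine ⟨(RingEquiv.ofBijective _ b₁).symm.trans (RingEquiv.ofBijective _ b₂), fun y => ?_⟩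
  rw [RingEquiv.trans_apply, show φ₁ y = RingEquiv.ofBijective _ b₁ ⟨Φ y, map_mem_valueRing y⟩
    from rfl, RingEquiv.symm_apply_apply]
  rfl

end Uniqueness

/-- Precomposition with a group automorphism preserves Hughes-freeness. -/
lemma IsHughesFreeEmbedding.comp_mapDomain {k : Type*} [DivisionRing k] {G : Type*} [Group G]
    {D : Type*} [DivisionRing D] {φ : MonoidAlgebra k G →+* D} (hφ : IsHughesFreeEmbedding φ)
    (α : G ≃* G) :
    IsHughesFreeEmbedding (φ.comp (MonoidAlgebra.mapDomainRingHom k α.toMonoidHom)) := by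
  have hcomp : ∀ {A B C : Type _} [Group A] [Group B] [Group C] (g : B →* C) (f : A →* B),
      (MonoidAlgebra.mapDomainRingHom k g).comp (MonoidAlgebra.mapDomainRingHom k f) =
        MonoidAlgebra.mapDomainRingHom k (g.comp f) := by
    intro A B C _ _ _ g f
    ext <;> simp
  have hsurj : Function.Surjective (MonoidAlgebra.mapDomainRingHom k α.toMonoidHom) := by
    intro y
    refine ⟨MonoidAlgebra.mapDomainRingHom k α.symm.toMonoidHom y, ?_⟩
    rw [← RingHom.comp_apply, hcomp]
    have : α.toMonoidHom.comp α.symm.toMonoidHom = MonoidHom.id G := by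
      ext x
      simp
    rw [this]
    simp
  refine ⟨hφ.1.comp (MonoidAlgebra.mapDomain_injective α.injective), ?_, ?_⟩
  · rw [RingHom.coe_comp, Set.range_comp, hsurj.range_eq, Set.image_univ]
    exact hφ.2.1
  · rintro H hH K t ⟨f, hf, rfl, ht⟩ c hc h0
    let e : H ≃* H.map α.toMonoidHom := H.equivMapOfInjective α.toMonoidHom α.injective
    have hfe : ∀ h, f.comp e.symm.toMonoidHom (e h) = f h := fun h =>
      congrArg f (e.symm_apply_apply h)
    refine hφ.2.2 (H.map α.toMonoidHom) ((Subgroup.fg_iff_submonoid_fg _).2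
      (((Subgroup.fg_iff_submonoid_fg _).1 hH).map α.toMonoidHom)) (f.comp e.symm.toMonoidHom).ker (e t)
      ⟨f.comp e.symm.toMonoidHom, hf.comp e.symm.surjective, rfl, (hfe t).trans ht⟩ c
      (fun i => ?_) ?_
    · have hle : Set.range ((φ.comp (MonoidAlgebra.mapDomainRingHom k α.toMonoidHom)).comp
          (MonoidAlgebra.mapDomainRingHom k (H.subtype.comp f.ker.subtype))) ⊆
          Set.range (φ.comp (MonoidAlgebra.mapDomainRingHom k
            ((H.map α.toMonoidHom).subtype.comp (f.comp e.symm.toMonoidHom).ker.subtype))) := by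
        let ι : f.ker →* (f.comp e.symm.toMonoidHom).ker :=
          (e.toMonoidHom.comp f.ker.subtype).codRestrict _ fun x => (hfe x).trans x.2
        rintro _ ⟨y, rfl⟩
        refine ⟨MonoidAlgebra.mapDomainRingHom k ι y, ?_⟩
        rw [RingHom.comp_assoc, hcomp, RingHom.comp_apply, ← RingHom.comp_apply (_ : _ →+* _) _ y,
          hcomp]
        rfl
      exact Subring.mem_sInf.2 fun S hS => Subring.mem_sInf.1 (hc i) S ⟨hS.1, hle.trans hS.2⟩
    · convert h0 using 6
      change _ = φ (MonoidAlgebra.mapDomain _ (MonoidAlgebra.single _ _))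
      rw [MonoidAlgebra.mapDomain_single]
      rfl

/-- If `φ : kH → D` is a Hughes-free embedding of the group algebra of a locally
indicable group `H` and `α : H → H` is a group automorphism, then the induced ring
automorphism `kα` of `kH` extends to a ring automorphism `α'` of `D`, i.e.
`α' ∘ φ = φ ∘ kα`. -/
theorem hughesFree_extend_automorphism
    {k : Type u} [DivisionRing k] {H : Type v} [Group H]
    (hH : LocallyIndicable H)
    {D : Type w} [DivisionRing D] (φ : MonoidAlgebra k H →+* D)
    (hφ : IsHughesFreeEmbedding φ) (α : H ≃* H) :
    ∃ α' : D ≃+* D, ∀ y : MonoidAlgebra k H,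
      α' (φ y) = φ (MonoidAlgebra.mapDomainRingHom k α.toMonoidHom y) := by
  obtain ⟨e, he⟩ := hφ.exists_ringEquiv hH (hφ.comp_mapDomain α)
  exact ⟨e, he⟩
end

section
/- Let k be a division ring, let G be a locally indicable group, let H ⊴ G be a normal subgroup of finite index, let R be a nonzero ring without zero divisors, and let φ : kG → R be a ring homomorphism. Suppose that E ⊆ R is a subring which is a division ring, that φ(kH) ⊆ E and the corestricted map φ|_{kH} : kH → E is a Hughes-free embedding, and that there is a set T of coset representatives of H in G with 1 ∈ T such that the family (φ(t))_{t∈T} is a basis of R as a left E-module. Then R is a division ring and φ : kG → R is a Hughes-free embedding. -/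
section DivisionSubrings

variable {R R' : Type*} [Ring R] [Ring R']

/-- In a ring all of whose nonzero elements are invertible, every division closure is a
division subring. -/
lemma isDivisionSubring_divisionClosure (hR : IsDivisionSubring (⊤ : Subring R)) (s : Set R) :
    IsDivisionSubring (divisionClosure s) := by
  intro x hx hx0
  obtain ⟨y, -, hxy, hyx⟩ := hR x trivial hx0
  refine ⟨y, Subring.mem_sInf.2 fun S hS => ?_, hxy, hyx⟩
  obtain ⟨z, hz, -, hzx⟩ := hS.1 x (Subring.mem_sInf.1 hx S hS) hx0
  rwa [← left_inv_eq_right_inv hzx hxy]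

lemma divisionClosure_le {s : Set R} {S : Subring R} (hS : IsDivisionSubring S) (hs : s ⊆ S) :
    divisionClosure s ≤ S :=
  sInf_le ⟨hS, hs⟩

lemma isDivisionSubring_top_of_divisionRing {E : Type*} [DivisionRing E] :
    IsDivisionSubring (⊤ : Subring E) :=
  fun x _ hx => ⟨x⁻¹, trivial, mul_inv_cancel₀ hx, inv_mul_cancel₀ hx⟩

lemma IsDivisionSubring.comap [Nontrivial R'] (hR : IsDivisionSubring (⊤ : Subring R))
    (f : R →+* R') {S : Subring R'} (hS : IsDivisionSubring S) :
    IsDivisionSubring (S.comap f) := by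
  intro x hx hx0
  obtain ⟨y, -, hxy, hyx⟩ := hR x trivial hx0
  have hfxy : f x * f y = 1 := by rw [← map_mul, hxy, map_one]
  obtain ⟨z, hz, -, hzx⟩ := hS (f x) hx (left_ne_zero_of_mul_eq_one hfxy)
  refine ⟨y, ?_, hxy, hyx⟩
  rw [left_inv_eq_right_inv hzx hfxy] at hz
  exact hz

lemma IsDivisionSubring.map (f : R →+* R') {S : Subring R} (hS : IsDivisionSubring S) :
    IsDivisionSubring (S.map f) := by
  rintro _ ⟨x, hx, rfl⟩ hx0
  obtain ⟨y, hy, hxy, hyx⟩ := hS x hx (fun h => hx0 (by simp [h]))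
  exact ⟨f y, ⟨y, hy, rfl⟩, by rw [← map_mul, hxy, map_one], by rw [← map_mul, hyx, map_one]⟩

/-- A domain which is finitely spanned, as a left module, over a division ring mapping to it,
has only invertible nonzero elements. -/
lemma exists_inverse_of_finite_span {E : Type*} [DivisionRing E] [NoZeroDivisors R]
    (j : E →+* R) {α : Type*} (I : Finset α) (w : α → R)
    (hw : ∀ x : R, ∃ d : α → E, x = ∑ i ∈ I, j (d i) * w i) (x : R) (hx : x ≠ 0) :
    ∃ y : R, x * y = 1 ∧ y * x = 1 := by
  let : Module E R := Module.compHom R j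
  have hsmul : ∀ (e : E) (r : R), e • r = j e * r := fun _ _ => rfl
  have hfin : Module.Finite E R := by
    classical
    refine ⟨⟨I.image w, top_unique fun y _ => ?_⟩⟩
    obtain ⟨d, rfl⟩ := hw y
    refine Submodule.sum_mem _ fun i hi => ?_
    rw [← hsmul]
    exact Submodule.smul_mem _ _ (Submodule.subset_span (by simpa using ⟨i, hi, rfl⟩))
  let m : R →ₗ[E] R :=
    { toFun := fun y => y * x
      map_add' := fun a b => add_mul a b x
      map_smul' := fun e a => by simp [hsmul, mul_assoc] }
  have hinj : Function.Injective m := by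
    refine (injective_iff_map_eq_zero m).2 fun y hy => ?_
    exact (mul_eq_zero.1 (show y * x = 0 from hy)).resolve_right hx
  obtain ⟨y, hy⟩ := LinearMap.surjective_of_injective hinj 1
  have hy : y * x = 1 := hy
  refine ⟨y, ?_, hy⟩
  have : (x * y - 1) * x = 0 := by rw [sub_mul, mul_assoc, hy, mul_one, one_mul, sub_self]
  exact sub_eq_zero.1 ((mul_eq_zero.1 this).resolve_right hx)

/-- The division subring form of `exists_inverse_of_finite_span`. -/
lemma isDivisionSubring_of_finite_span [Nontrivial R] [NoZeroDivisors R] {D S : Subring R}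
    (hD : IsDivisionSubring D) (hDS : D ≤ S) {α : Type*} (I : Finset α) (w : α → R)
    (hwS : ∀ i, w i ∈ S)
    (hw : ∀ x ∈ S, ∃ d : α → R, (∀ i, d i ∈ D) ∧ x = ∑ i ∈ I, d i * w i) :
    IsDivisionSubring S := by
  intro x hxS hx0
  let : DivisionRing D := DivisionRing.ofIsUnitOrEqZero fun a => by
    by_cases ha : a = 0
    · exact Or.inr ha
    · obtain ⟨y, hy, hay, hya⟩ := hD a a.2 (by simpa using ha)
      exact Or.inl (isUnit_iff_exists.2 ⟨⟨y, hy⟩, Subtype.ext hay, Subtype.ext hya⟩)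
  obtain ⟨y, hxy, hyx⟩ := exists_inverse_of_finite_span (Subring.inclusion hDS) I
    (fun i => (⟨w i, hwS i⟩ : S)) (fun z => by
      obtain ⟨d, hd, hz⟩ := hw z z.2
      refine ⟨fun i => ⟨d i, hd i⟩, Subtype.ext ?_⟩
      simpa using hz) ⟨x, hxS⟩ (by simpa using hx0)
  exact ⟨y, y.2, congrArg Subtype.val hxy, congrArg Subtype.val hyx⟩

end DivisionSubrings

section GroupAlgebra

variable {k : Type*} [DivisionRing k] {G : Type*} [Group G] {R : Type*} [Ring R]

lemma MonoidAlgebra.range_comp_mapDomainRingHom_subset {P : Type*} [Group P]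
    (φ : MonoidAlgebra k G →+* R) (j : P →* G) {S : Subring R}
    (h : ∀ (p : P) (a : k), φ (.single (j p) a) ∈ S) :
    Set.range (φ.comp (MonoidAlgebra.mapDomainRingHom k j)) ⊆ S := by
  rintro _ ⟨x, rfl⟩
  induction x using MonoidAlgebra.induction_linear with
  | zero => simp
  | add x y hx hy => rw [map_add]; exact add_mem hx hy
  | single m r => simpa using h m r

lemma MonoidAlgebra.map_single_eq_mul (φ : MonoidAlgebra k G →+* R) (g : G) (a : k) :
    φ (.single g a) = φ (.single 1 a) * φ (.of k G g) := by
  rw [← map_mul]; simp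

lemma MonoidAlgebra.map_of_mul_map_of_inv (φ : MonoidAlgebra k G →+* R) (g : G) :
    φ (.of k G g) * φ (.of k G g⁻¹) = 1 := by
  rw [← map_mul, ← map_mul, mul_inv_cancel, map_one, map_one]

lemma MonoidAlgebra.map_of_inv_mul_map_of (φ : MonoidAlgebra k G →+* R) (g : G) :
    φ (.of k G g⁻¹) * φ (.of k G g) = 1 := by
  simpa using map_of_mul_map_of_inv φ g⁻¹

lemma MonoidAlgebra.mul_map_of_eq_zero_iff (φ : MonoidAlgebra k G →+* R) (g : G) {x : R} :
    x * φ (.of k G g) = 0 ↔ x = 0 := by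
  refine ⟨fun h => ?_, fun h => by simp [h]⟩
  have := congrArg (· * φ (.of k G g⁻¹)) h
  simpa only [mul_assoc, map_of_mul_map_of_inv, mul_one, zero_mul] using this

lemma ringZPow_map_of (φ : MonoidAlgebra k G →+* R) (g : G) (i : ℤ) :
    ringZPow (φ (.of k G g)) i = φ (.of k G (g ^ i)) := by
  unfold ringZPow
  split_ifs with h
  · rw [← map_pow, ← map_pow, ← zpow_natCast, Int.toNat_of_nonneg h]
  · have hinv : Ring.inverse (φ (.of k G g)) = φ (.of k G g⁻¹) :=
      Ring.inverse_unit (⟨_, _, MonoidAlgebra.map_of_mul_map_of_inv φ g,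
        MonoidAlgebra.map_of_inv_mul_map_of φ g⟩ : Rˣ)
    rw [hinv, ← map_pow, ← map_pow, ← zpow_natCast, Int.toNat_of_nonneg (by omega), inv_zpow',
      neg_neg]

/-- Conjugation by the image of a group element, as a ring endomorphism. -/
noncomputable def conjRingHom (φ : MonoidAlgebra k G →+* R) (g : G) : R →+* R where
  toFun x := φ (.of k G g) * x * φ (.of k G g⁻¹)
  map_one' := by rw [mul_one, MonoidAlgebra.map_of_mul_map_of_inv]
  map_zero' := by simp
  map_add' x y := by rw [mul_add, add_mul]
  map_mul' x y := by
    have h := MonoidAlgebra.map_of_inv_mul_map_of φ g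
    calc φ (.of k G g) * (x * y) * φ (.of k G g⁻¹)
        = φ (.of k G g) * x * 1 * y * φ (.of k G g⁻¹) := by simp only [mul_assoc, mul_one]
      _ = _ := by rw [← h]; simp only [mul_assoc]

lemma conjRingHom_map_single (φ : MonoidAlgebra k G →+* R) (g p : G) (a : k) :
    conjRingHom φ g (φ (.single p a)) = φ (.single (g * p * g⁻¹) a) := by
  change φ _ * φ _ * φ _ = _
  rw [← map_mul, ← map_mul]; simp

/-- The division closure of the image of the group algebra of a subgroup. -/
def subgroupDivisionClosure (φ : MonoidAlgebra k G →+* R) (P : Subgroup G) : Subring R :=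
  divisionClosure {x | ∃ p ∈ P, ∃ a : k, φ (.single p a) = x}

lemma map_single_mem_subgroupDivisionClosure (φ : MonoidAlgebra k G →+* R) {P : Subgroup G}
    {p : G} (hp : p ∈ P) (a : k) : φ (.single p a) ∈ subgroupDivisionClosure φ P :=
  subset_divisionClosure _ ⟨p, hp, a, rfl⟩

lemma conjRingHom_mem_subgroupDivisionClosure [Nontrivial R]
    (hR : IsDivisionSubring (⊤ : Subring R)) (φ : MonoidAlgebra k G →+* R) {P : Subgroup G}
    {g : G} (hg : ∀ p ∈ P, g * p * g⁻¹ ∈ P) {x : R} (hx : x ∈ subgroupDivisionClosure φ P) :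
    conjRingHom φ g x ∈ subgroupDivisionClosure φ P := by
  refine divisionClosure_le (S := (subgroupDivisionClosure φ P).comap (conjRingHom φ g))
    (IsDivisionSubring.comap hR _ (isDivisionSubring_divisionClosure hR _)) ?_ hx
  rintro _ ⟨p, hp, a, rfl⟩
  change conjRingHom φ g (φ _) ∈ subgroupDivisionClosure φ P
  rw [conjRingHom_map_single]
  exact map_single_mem_subgroupDivisionClosure φ (hg p hp) a

/-- If `P` is normalized by `K ⊇ P` and the finite set `F ⊆ K` meets every right coset of `P`
in `K`, then `F` spans the division closure of `kK` over that of `kP`. -/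
lemma exists_sum_of_mem_subgroupDivisionClosure [Nontrivial R] [NoZeroDivisors R]
    (hR : IsDivisionSubring (⊤ : Subring R)) (φ : MonoidAlgebra k G →+* R) {P K : Subgroup G}
    (hPK : ∀ g ∈ K, ∀ p ∈ P, g * p * g⁻¹ ∈ P) (F : Finset G) (hFK : ∀ g ∈ F, g ∈ K)
    (hF : ∀ g ∈ K, ∃ g' ∈ F, g * g'⁻¹ ∈ P) {x : R} (hx : x ∈ subgroupDivisionClosure φ K) :
    ∃ d : G → R, (∀ g, d g ∈ subgroupDivisionClosure φ P) ∧
      x = ∑ g ∈ F, d g * φ (.of k G g) := by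
  classical
  set D := subgroupDivisionClosure φ P
  have hD : IsDivisionSubring D := isDivisionSubring_divisionClosure hR _
  let M : Submonoid R :=
    { carrier := {x | ∃ d ∈ D, ∃ g ∈ K, x = d * φ (.of k G g)}
      one_mem' := ⟨1, one_mem _, 1, one_mem _, by simp [← MonoidAlgebra.one_def]⟩
      mul_mem' := by
        rintro _ _ ⟨d, hd, g, hg, rfl⟩ ⟨d', hd', g', hg', rfl⟩
        refine ⟨d * conjRingHom φ g d',
          mul_mem hd (conjRingHom_mem_subgroupDivisionClosure hR φ (hPK g hg) hd'),
          g * g', mul_mem hg hg', ?_⟩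
        change _ = d * (φ (.of k G g) * d' * φ (.of k G g⁻¹)) * _
        rw [map_mul, map_mul]
        calc d * φ (.of k G g) * (d' * φ (.of k G g'))
            = d * φ (.of k G g) * d' * 1 * φ (.of k G g') := by simp only [mul_assoc, one_mul]
          _ = _ := by
            rw [← MonoidAlgebra.map_of_inv_mul_map_of φ g]; simp only [mul_assoc] }
  let S := Subring.closure (M : Set R)
  have hMS : ∀ x ∈ M, x ∈ S := fun x hx => Subring.subset_closure hx
  have hspan : ∀ x ∈ S, ∃ d : G → R, (∀ g, d g ∈ D) ∧ x = ∑ g ∈ F, d g * φ (.of k G g) := by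
    intro x hx
    rw [Subring.mem_closure_iff, Submonoid.closure_eq] at hx
    induction hx using AddSubgroup.closure_induction with
    | mem x hx =>
      obtain ⟨d, hd, g, hg, rfl⟩ := hx
      obtain ⟨g', hg', hp⟩ := hF g hg
      refine ⟨Pi.single g' (d * φ (.of k G (g * g'⁻¹))), fun y => ?_, ?_⟩
      · by_cases hy : y = g'
        · subst hy
          rw [Pi.single_eq_same]
          exact mul_mem hd (map_single_mem_subgroupDivisionClosure φ hp 1)
        · rw [Pi.single_eq_of_ne hy]; exact zero_mem _
      · rw [Finset.sum_eq_single_of_mem g' hg' fun b _ hb => by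
          rw [Pi.single_eq_of_ne hb, zero_mul], Pi.single_eq_same, mul_assoc, ← map_mul, ← map_mul,
          inv_mul_cancel_right]
    | zero => exact ⟨0, fun _ => zero_mem _, by simp⟩
    | add x y _ _ hx hy =>
      obtain ⟨d, hd, rfl⟩ := hx
      obtain ⟨d', hd', rfl⟩ := hy
      exact ⟨d + d', fun g => add_mem (hd g) (hd' g), by simp [add_mul, Finset.sum_add_distrib]⟩
    | neg x _ hx =>
      obtain ⟨d, hd, rfl⟩ := hx
      exact ⟨-d, fun g => neg_mem (hd g), by simp⟩
  have hDS : D ≤ S := fun d hd =>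
    hMS _ ⟨d, hd, 1, one_mem _, by simp [← MonoidAlgebra.one_def]⟩
  have hKS : ∀ g ∈ K, φ (.of k G g) ∈ S := fun g hg =>
    hMS _ ⟨1, one_mem _, g, hg, by simp⟩
  have hS : IsDivisionSubring S := by
    refine isDivisionSubring_of_finite_span hD hDS F.attach (fun g => φ (.of k G g.1))
      (fun g => hKS g.1 (hFK g.1 g.2)) fun x hx => ?_
    obtain ⟨d, hd, hx⟩ := hspan x hx
    refine ⟨fun g => d g.1, fun g => hd g.1, ?_⟩
    rw [hx, ← Finset.sum_attach]
  refine hspan x (divisionClosure_le hS ?_ hx)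
  rintro _ ⟨g, hg, a, rfl⟩
  rw [MonoidAlgebra.map_single_eq_mul]
  exact mul_mem (hDS (map_single_mem_subgroupDivisionClosure φ (one_mem _) a)) (hKS g hg)

/-- Every set has a finite transversal modulo a subgroup of finite index. -/
lemma exists_finset_transversal (H : Subgroup G) [H.FiniteIndex] (A : Set G) :
    ∃ F : Finset G, (∀ g ∈ F, g ∈ A) ∧
      Set.InjOn (QuotientGroup.mk : G → G ⧸ H) F ∧
      ∀ g ∈ A, ∃ g' ∈ F, (QuotientGroup.mk g' : G ⧸ H) = QuotientGroup.mk g := by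
  obtain ⟨s, hsA, hs⟩ := Set.exists_subset_bijOn A (QuotientGroup.mk : G → G ⧸ H)
  have hfin : s.Finite := Set.Finite.of_finite_image (Set.toFinite _) hs.injOn
  refine ⟨hfin.toFinset, fun g hg => hsA (by simpa using hg), by simpa using hs.injOn,
    fun g hg => ?_⟩
  obtain ⟨g', hg', h⟩ := hs.surjOn ⟨g, hg, rfl⟩
  exact ⟨g', by simpa using hg', h⟩

/-- A homogeneous form of Hughes-freeness: elements of a finitely generated group with distinct
images under a homomorphism to `ℤ` are independent over the division closure of its kernel. -/
lemma IsHughesFreeEmbedding.eq_zero_of_sum_eq_zero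
    {ψ : MonoidAlgebra k G →+* R} (hψ : IsHughesFreeEmbedding ψ) {L : Subgroup G} (hL : L.FG)
    (f : L →* Multiplicative ℤ) {α : Type*} (I : Finset α) (h : α → L)
    (hinj : Set.InjOn (fun i => f (h i)) I) (e : α → R)
    (he : ∀ i ∈ I, e i ∈ divisionClosure (Set.range
      (ψ.comp (MonoidAlgebra.mapDomainRingHom k (L.subtype.comp f.ker.subtype)))))
    (hsum : ∑ i ∈ I, e i * ψ (.of k G (h i)) = 0) : ∀ i ∈ I, e i = 0 := by
  classical
  intro i₀ hi₀
  by_cases hf : f.range = ⊥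
  · have h1 : ∀ x, f x = 1 := fun x => by
      have : f x ∈ f.range := ⟨x, rfl⟩
      rwa [hf, Subgroup.mem_bot] at this
    rw [Finset.sum_eq_single_of_mem i₀ hi₀
      fun b hb hne => absurd (hinj hb hi₀ (by simp only [h1])) hne] at hsum
    exact (MonoidAlgebra.mul_map_of_eq_zero_iff ψ _).1 hsum
  have hinf : Infinite f.range := by
    obtain ⟨x, hx1⟩ := Subgroup.ne_bot_iff_exists_ne_one.1 hf
    exact Infinite.of_injective (fun n : ℤ => x ^ n)
      (injective_zpow_iff_not_isOfFinOrder.2 fun hfo => hx1 ((isOfFinOrder_iff_eq_one x).1 hfo))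
  let q : Multiplicative ℤ ≃* f.range := intCyclicMulEquiv
  let f' : L →* Multiplicative ℤ := q.symm.toMonoidHom.comp f.rangeRestrict
  have hf's : Function.Surjective f' := q.symm.surjective.comp f.rangeRestrict_surjective
  have hker : f'.ker = f.ker := by
    ext x
    simp [f', MonoidHom.mem_ker]
  have hff' : ∀ x y, f' x = f' y → f x = f y := fun x y hxy => by
    simpa [f', Subtype.ext_iff] using hxy
  obtain ⟨s, hs⟩ := hf's (Multiplicative.ofAdd 1)
  let n : α → ℤ := fun i => Multiplicative.toAdd (f' (h i))
  have hn : ∀ i, f' (s ^ n i) = f' (h i) := fun i => by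
    rw [map_zpow, hs, ← ofAdd_zsmul]; simp [n]
  have hκ : ∀ i, h i * (s ^ n i)⁻¹ ∈ f.ker := fun i => by
    rw [← hker, MonoidHom.mem_ker, map_mul, map_inv, hn, mul_inv_cancel]
  let w : α → R := fun i => e i * ψ (.of k G (h i * (s ^ n i)⁻¹ : L))
  let c : ℤ →₀ R := ∑ i ∈ I, Finsupp.single (n i) (w i)
  have hc0 : c = 0 := by
    refine hψ.2.2 L hL f.ker s ⟨f', hf's, hker, hs⟩ c (fun j => ?_) ?_
    · rw [Finsupp.finsetSum_apply]
      refine sum_mem fun i hi => ?_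
      rw [Finsupp.single_apply]
      split_ifs
      · refine mul_mem (he i hi) (subset_divisionClosure _ ?_)
        exact ⟨.single ⟨_, hκ i⟩ 1, by simp⟩
      · exact zero_mem _
    · rw [← Finsupp.sum_finsetSum_index (by simp) (by simp [add_mul]), ← hsum]
      refine Finset.sum_congr rfl fun i _ => ?_
      rw [Finsupp.sum_single_index (by simp), ringZPow_map_of, mul_assoc, ← map_mul, ← map_mul]
      simp
  have hi := DFunLike.congr_fun hc0 (n i₀)
  rw [Finsupp.finsetSum_apply, Finset.sum_eq_single_of_mem i₀ hi₀, Finsupp.single_eq_same] at hi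
  · exact (MonoidAlgebra.mul_map_of_eq_zero_iff ψ _).1 hi
  · intro b hb hne
    refine Finsupp.single_eq_of_ne fun hnb => hne (hinj hb hi₀ (hff' _ _ ?_))
    exact Multiplicative.toAdd.injective hnb.symm

end GroupAlgebra

section Cosets

variable {k : Type*} [DivisionRing k] {G : Type*} [Group G] {R : Type*} [Ring R]
  {E : Type*} [DivisionRing E]

lemma map_map_of_eq {H : Subgroup G} {φ : MonoidAlgebra k G →+* R} {ι : E →+* R}
    {ψ : MonoidAlgebra k H →+* E}
    (hcomp : ι.comp ψ = φ.comp (MonoidAlgebra.mapDomainRingHom k H.subtype)) (h : H) (a : k) :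
    ι (ψ (.single h a)) = φ (.single (h : G) a) := by
  simpa using DFunLike.congr_fun hcomp (.single h a)

/-- If coset representatives are left independent over `E`, then every linear relation among
images of group elements splits into relations supported on single cosets; translating the coset
of `x` to `H` gives a relation over `kH`. -/
lemma exists_sum_coset_eq_zero {H : Subgroup G} (hnorm : H.Normal)
    {φ : MonoidAlgebra k G →+* R} {ι : E →+* R}
    {ψ : MonoidAlgebra k H →+* E}
    (hcomp : ι.comp ψ = φ.comp (MonoidAlgebra.mapDomainRingHom k H.subtype)) (T : Set G)
    (hTrep : ∀ g : G, ∃! t : G, t ∈ T ∧ (QuotientGroup.mk t : G ⧸ H) = QuotientGroup.mk g)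
    (hindep : ∀ c : T →₀ E,
      (c.sum fun t e => ι e * φ (MonoidAlgebra.of k G (t : G))) = 0 → c = 0)
    {α : Type*} (I : Finset α) (e : α → E) (g : α → G)
    (hsum : ∑ i ∈ I, ι (e i) * φ (.of k G (g i)) = 0) (x : G) :
    ∃ (J : Finset α) (h : α → H),
      (∀ i, i ∈ J ↔ i ∈ I ∧ (QuotientGroup.mk (g i) : G ⧸ H) = QuotientGroup.mk x) ∧
      (∀ i ∈ J, (h i : G) = g i * x⁻¹) ∧ ∑ i ∈ J, e i * ψ (.of k H (h i)) = 0 := by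
  classical
  have hmem : ∀ a b : G, (QuotientGroup.mk a : G ⧸ H) = QuotientGroup.mk b → a * b⁻¹ ∈ H :=
    fun a b hab => hnorm.mem_comm (QuotientGroup.eq.1 hab.symm)
  have hrep : ∀ y : G, ∃ t : T, (QuotientGroup.mk (t : G) : G ⧸ H) = QuotientGroup.mk y := by
    intro y
    obtain ⟨t, ⟨ht, hty⟩, -⟩ := hTrep y
    exact ⟨⟨t, ht⟩, hty⟩
  choose τ hτ using hrep
  have hτeq : ∀ y z : G, τ y = τ z ↔ (QuotientGroup.mk y : G ⧸ H) = QuotientGroup.mk z := by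
    intro y z
    refine ⟨fun hyz => by rw [← hτ y, hyz, hτ z], fun hyz => Subtype.ext ?_⟩
    exact (hTrep y).unique ⟨(τ y).2, hτ y⟩ ⟨(τ z).2, (hτ z).trans hyz.symm⟩
  let b : G → H := fun y => ⟨y * (τ y : G)⁻¹, hmem _ _ (hτ y).symm⟩
  have hof : ∀ h : H, ι (ψ (.of k H h)) = φ (.of k G h) := fun h => map_map_of_eq hcomp h 1
  let c : T →₀ E := ∑ i ∈ I, Finsupp.single (τ (g i)) (e i * ψ (.of k H (b (g i))))
  have hc : c = 0 := by
    refine hindep c ?_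
    rw [← Finsupp.sum_finsetSum_index (by simp) (by simp [add_mul]), ← hsum]
    refine Finset.sum_congr rfl fun i _ => ?_
    rw [Finsupp.sum_single_index (by simp), map_mul, hof, mul_assoc, ← map_mul, ← map_mul]
    simp [b]
  refine ⟨I.filter fun i => (QuotientGroup.mk (g i) : G ⧸ H) = QuotientGroup.mk x,
    fun i => b (g i) * (b x)⁻¹, by simp, fun i hi => ?_, ?_⟩
  · rw [Finset.mem_filter, ← hτeq] at hi
    simp [b, hi.2]
  · have hx := DFunLike.congr_fun hc (τ x)
    simp only [c, Finsupp.finsetSum_apply, Finsupp.single_apply, hτeq, Finsupp.coe_zero,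
      Pi.zero_apply, ← Finset.sum_filter] at hx
    simp only [map_mul, ← mul_assoc, ← Finset.sum_mul, hx, zero_mul]

end Cosets

/-- The intersection of a finitely generated subgroup with a subgroup of finite index is finitely
generated. -/
lemma Subgroup.FG.subgroupOf_of_finiteIndex {G : Type*} [Group G] {L : Subgroup G} (hL : L.FG)
    (H : Subgroup G) [H.FiniteIndex] : (L.subgroupOf H).FG := by
  have : Group.FG L := (Group.fg_iff_subgroup_fg L).2 hL
  let f : H.subgroupOf L →* L.subgroupOf H :=
    { toFun x := ⟨⟨x.1.1, x.2⟩, x.1.2⟩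
      map_one' := rfl
      map_mul' _ _ := rfl }
  have hf : Function.Surjective f := fun y => ⟨⟨⟨y.1.1, y.2⟩, y.1.2⟩, rfl⟩
  exact (Group.fg_iff_subgroup_fg _).1 (Group.fg_of_surjective hf)

/-- Let `G` be locally indicable, `H ⊴ G` of finite index, `R` a nonzero ring without
zero divisors and `φ : kG → R` a ring homomorphism.  Suppose `E` is a division ring
embedded in `R` via `ι`, that `φ` restricted to `kH` corestricts to a Hughes-free
embedding `ψ : kH → E`, and that there is a set `T` of coset representatives of `H` in
`G` with `1 ∈ T` such that `(φ t)_{t ∈ T}` is a basis of `R` as a left `E`-module.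
Then `R` is a division ring and `φ` is a Hughes-free embedding of `kG`. -/
theorem crossedProduct_domain_hughesFree
    {k : Type u} [DivisionRing k] {G : Type v} [Group G]
    (hG : LocallyIndicable G)
    (H : Subgroup G) (hnorm : H.Normal) (hfi : H.FiniteIndex)
    {R : Type w} [Ring R] [Nontrivial R] [NoZeroDivisors R]
    (φ : MonoidAlgebra k G →+* R)
    {E : Type x} [DivisionRing E] (ι : E →+* R) (hι : Function.Injective ι)
    (ψ : MonoidAlgebra k H →+* E)
    (hcomp : ι.comp ψ = φ.comp (MonoidAlgebra.mapDomainRingHom k H.subtype))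
    (hψ : IsHughesFreeEmbedding ψ)
    (T : Set G) (hT1 : (1 : G) ∈ T)
    (hTrep : ∀ g : G, ∃! t : G, t ∈ T ∧
      (QuotientGroup.mk t : G ⧸ H) = QuotientGroup.mk g)
    (hindep : ∀ c : T →₀ E,
      (c.sum fun t e => ι e * φ (MonoidAlgebra.of k G (t : G))) = 0 → c = 0)
    (hspan : ∀ r : R, ∃ c : T →₀ E,
      r = c.sum fun t e => ι e * φ (MonoidAlgebra.of k G (t : G))) :
    (∀ r : R, r ≠ 0 → ∃ s : R, r * s = 1 ∧ s * r = 1) ∧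
      IsHughesFreeEmbedding φ := by
  have hspanT : ∃ (I : Finset T), ∀ r : R, ∃ d : T → E,
      r = ∑ t ∈ I, ι (d t) * φ (MonoidAlgebra.of k G (t : G)) := by
    have : Finite T := Finite.of_injective (fun t : T => (QuotientGroup.mk (t : G) : G ⧸ H))
      fun s t hst => Subtype.ext ((hTrep t).unique ⟨s.2, hst⟩ ⟨t.2, rfl⟩)
    have : Fintype T := Fintype.ofFinite T
    refine ⟨Finset.univ, fun r => ?_⟩
    obtain ⟨c, rfl⟩ := hspan r
    exact ⟨c, Finsupp.sum_fintype _ _ (by simp)⟩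
  obtain ⟨I, hI⟩ := hspanT
  have hR : ∀ r : R, r ≠ 0 → ∃ s : R, r * s = 1 ∧ s * r = 1 :=
    exists_inverse_of_finite_span ι I _ hI
  have hRdiv : IsDivisionSubring (⊤ : Subring R) := fun x _ hx =>
    let ⟨y, hy⟩ := hR x hx
    ⟨y, trivial, hy⟩
  refine ⟨hR, ?_, ?_, ?_⟩
  · refine (injective_iff_map_eq_zero φ).2 fun x hx => ?_
    by_contra hx0
    obtain ⟨g₀, hg₀⟩ := Finsupp.ne_iff.1 (mt MonoidAlgebra.coeff_eq_zero.1 hx0)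
    have hsum : ∑ g ∈ x.coeff.support, ι (ψ (.single 1 (x.coeff g))) * φ (.of k G g) = 0 := by
      rw [← hx]
      conv_rhs => rw [← MonoidAlgebra.sum_coeff_single x, Finsupp.sum, map_sum]
      refine Finset.sum_congr rfl fun g _ => ?_
      rw [map_map_of_eq hcomp, MonoidAlgebra.map_single_eq_mul φ g]
      simp
    obtain ⟨J, h, hJ, hh, hJsum⟩ :=
      exists_sum_coset_eq_zero hnorm hcomp T hTrep hindep _ _ _ hsum g₀
    have hψ0 : ψ (∑ g ∈ J, .single (h g) (x.coeff g)) = 0 := by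
      rw [map_sum, ← hJsum]
      exact Finset.sum_congr rfl fun g _ => MonoidAlgebra.map_single_eq_mul ψ _ _
    have h0 := congrArg (fun y => MonoidAlgebra.coeff y 1)
      ((injective_iff_map_eq_zero ψ).1 hψ.1 _ hψ0)
    have hg₀J : g₀ ∈ J := (hJ g₀).2 ⟨by simpa using hg₀, rfl⟩
    have h1 : ∀ g ∈ J, (h g = 1 ↔ g = g₀) := fun g hg => by
      rw [← OneMemClass.coe_eq_one, hh g hg, mul_inv_eq_one]
    simp only [MonoidAlgebra.coeff_sum, Finsupp.finsetSum_apply, MonoidAlgebra.coeff_zero,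
      Finsupp.coe_zero, Pi.zero_apply] at h0
    rw [Finset.sum_eq_single_of_mem g₀ hg₀J fun g hg hne => ?_] at h0
    · rw [(h1 g₀ hg₀J).2 rfl] at h0
      exact hg₀ (by simpa using h0)
    · simp [h1 g hg, hne]
  · refine top_unique fun r _ => Subring.mem_sInf.2 fun S hS => ?_
    have hE : ∀ e : E, ι e ∈ S := fun e => by
      have hle : divisionClosure (Set.range ψ) ≤ S.comap ι := by
        refine divisionClosure_le
          (IsDivisionSubring.comap isDivisionSubring_top_of_divisionRing ι hS.1) ?_
        rintro _ ⟨y, rfl⟩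
        exact hS.2 ⟨_, (DFunLike.congr_fun hcomp y).symm⟩
      exact hle (hψ.2.1 ▸ Subring.mem_top e)
    obtain ⟨d, rfl⟩ := hI r
    exact sum_mem fun t _ => mul_mem (hE _) (hS.2 ⟨_, rfl⟩)
  · rintro L hL _ t ⟨f, -, rfl, hft⟩ c hc hcsum
    let L' : Subgroup H := L.subgroupOf H
    let incl : L' →* L :=
      { toFun x := ⟨x.1.1, x.2⟩
        map_one' := rfl
        map_mul' _ _ := rfl }
    let f' : L' →* Multiplicative ℤ := f.comp incl
    let K : Subgroup G := f.ker.map L.subtype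
    have hKL : ∀ g ∈ K, ∃ hg : g ∈ L, f ⟨g, hg⟩ = 1 := by
      rintro _ ⟨g, hg, rfl⟩
      exact ⟨g.2, hg⟩
    obtain ⟨F, hFK, hFinj, hF⟩ := exists_finset_transversal H (K : Set G)
    have hF' : ∀ g ∈ K, ∃ g' ∈ F, g * g'⁻¹ ∈ K ⊓ H := fun g hg => by
      obtain ⟨g', hg', hgg'⟩ := hF g hg
      exact ⟨g', hg', K.mul_mem hg (K.inv_mem (hFK g' hg')),
        hnorm.mem_comm (QuotientGroup.eq.1 hgg')⟩
    have hconj : ∀ g ∈ K, ∀ p ∈ K ⊓ H, g * p * g⁻¹ ∈ K ⊓ H := fun g hg p hp =>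
      ⟨K.mul_mem (K.mul_mem hg hp.1) (K.inv_mem hg), hnorm.conj_mem p hp.2 g⟩
    have hcK : ∀ i, c i ∈ subgroupDivisionClosure φ K := fun i => by
      refine divisionClosure_le (isDivisionSubring_divisionClosure hRdiv _) ?_ (hc i)
      exact MonoidAlgebra.range_comp_mapDomainRingHom_subset φ _ fun p a =>
        map_single_mem_subgroupDivisionClosure φ
          (Subgroup.mem_map_of_mem L.subtype p.2) a
    choose d hd hcd using fun i => exists_sum_of_mem_subgroupDivisionClosure hRdiv φ hconj F
      hFK hF' (hcK i)
    let D : Subring E := divisionClosure (Set.range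
      (ψ.comp (MonoidAlgebra.mapDomainRingHom k (L'.subtype.comp f'.ker.subtype))))
    have hDE : subgroupDivisionClosure φ (K ⊓ H) ≤ D.map ι := by
      refine divisionClosure_le (IsDivisionSubring.map ι
        (isDivisionSubring_divisionClosure isDivisionSubring_top_of_divisionRing _)) ?_
      rintro _ ⟨p, ⟨hpK, hpH⟩, a, rfl⟩
      obtain ⟨hpL, hfp⟩ := hKL p hpK
      refine ⟨ψ (.single ⟨p, hpH⟩ a), subset_divisionClosure _ ?_, map_map_of_eq hcomp _ a⟩
      exact ⟨.single ⟨⟨⟨p, hpH⟩, hpL⟩, hfp⟩ a, by simp⟩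
    choose e he hed using fun i g => hDE (hd i g)
    have hsum : ∑ p ∈ c.support ×ˢ F, ι (e p.1 p.2) * φ (.of k G (p.2 * (t : G) ^ p.1)) = 0 := by
      rw [← hcsum, Finsupp.sum, Finset.sum_product]
      refine Finset.sum_congr rfl fun i _ => ?_
      conv_rhs => rw [hcd i, Finset.sum_mul]
      refine Finset.sum_congr rfl fun g _ => ?_
      rw [hed, ringZPow_map_of, mul_assoc, ← map_mul, ← map_mul]
      rfl
    have he0 : ∀ i ∈ c.support, ∀ g ∈ F, e i g = 0 := by
      intro i₀ hi₀ g₀ hg₀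
      obtain ⟨J, h, hJ, hh, hJsum⟩ := exists_sum_coset_eq_zero hnorm hcomp T hTrep hindep
        _ (fun p : ℤ × G => e p.1 p.2) _ hsum (g₀ * (t : G) ^ i₀)
      have hJF : ∀ p ∈ J, p.2 ∈ F := fun p hp => (Finset.mem_product.1 ((hJ p).1 hp).1).2
      have hl : ∀ p, ∃ l : L', p ∈ J →
          l.1 = h p ∧ f' l = Multiplicative.ofAdd (p.1 - i₀) := by
        intro p
        by_cases hp : p ∈ J
        · obtain ⟨hpL, hfp⟩ := hKL p.2 (hFK _ (hJF p hp))
          obtain ⟨hgL, hfg⟩ := hKL g₀ (hFK _ hg₀)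
          have hlL : h p = ((⟨p.2, hpL⟩ * t ^ p.1 * (⟨g₀, hgL⟩ * t ^ i₀)⁻¹ : L) : G) := by
            rw [hh p hp]; rfl
          have hpL' : (h p : G) ∈ L := hlL ▸ Subtype.prop _
          refine ⟨⟨h p, hpL'⟩, fun _ => ⟨rfl, ?_⟩⟩
          refine (congrArg f (Subtype.ext hlL : (⟨h p, hpL'⟩ : L) = _)).trans ?_
          simp only [map_mul, map_inv, map_zpow, hfp, hfg, hft, one_mul, ← ofAdd_zsmul]
          simp [sub_eq_add_neg]
        · exact ⟨1, fun hp' => absurd hp' hp⟩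
      choose l hl using hl
      refine hψ.eq_zero_of_sum_eq_zero (hL.subgroupOf_of_finiteIndex H) f' J l ?_
        (fun p => e p.1 p.2) (fun p _ => he p.1 p.2) ?_ (i₀, g₀)
        ((hJ _).2 ⟨Finset.mk_mem_product hi₀ hg₀, rfl⟩)
      · intro p hp q hq hpq
        simp only [(hl p hp).2, (hl q hq).2] at hpq
        have h1 : p.1 = q.1 := sub_left_injective (Multiplicative.ofAdd.injective hpq)
        have h2 : (QuotientGroup.mk p.2 : G ⧸ H) = QuotientGroup.mk q.2 := by
          have := ((hJ p).1 hp).2.trans ((hJ q).1 hq).2.symm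
          rw [h1] at this
          simpa using this
        exact Prod.ext h1 (hFinj (hJF p hp) (hJF q hq) h2)
      · rw [← hJsum]
        exact Finset.sum_congr rfl fun p hp => by rw [(hl p hp).1]
    ext i
    by_cases hi : i ∈ c.support
    · rw [hcd i]
      refine Finset.sum_eq_zero fun g hg => ?_
      rw [← hed, he0 i hi g hg, map_zero, zero_mul]
    · simpa using hi
end
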